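/- arXiv:1210.2706 — 9 statements merged into one kernel-verified Lean document; each statement's English description precedes it below -/
import Mathlib

section
/- Assume conditions (C3), (C5) and (C6). Then the sequence of centered, normalized optimal values converges to the optimal value of the limiting problem: (F_n(x_n*) - a_n)/b_n → inf_{x ∈ X̄} π̄(x) as n → ∞. -/
open Filter Topology Set

/-- Under conditions (C3), (C5) and (C6), the centered, normalized optimal
values converge to the optimal value of the limiting problem:
`(F_n(x_n*) - a_n)/b_n → inf_{x ∈ X̄} π̄(x)` as `n → ∞`. -/
theorem normalized_optimal_value_convergence
    {M : Type*} [MetricSpace M]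
    (Xn : ℕ → Set M) (hne : ∀ n, (Xn n).Nonempty)
    (hmono : ∀ n, Xn n ⊆ Xn (n + 1))
    (Xbar : Set M) (hXbar : Xbar = ⋃ n, Xn n)
    (a b : ℕ → ℝ) (hbpos : ∀ n, 0 < b n) (hbtop : Tendsto b atTop atTop)
    (pibar pihat : M → ℝ) (eps : ℕ → M → ℝ)
    (F : ℕ → M → ℝ)
    (hF : ∀ n, ∀ x ∈ Xn n, F n x = a n + b n * pibar x + pihat x + eps n x)
    (Xstar : Set M)
    (hXstar : Xstar = {x ∈ Xbar | ∀ y ∈ Xbar, pibar x ≤ pibar y})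
    -- (C3): `inf_{x ∈ X̄} π̄(x) > -∞` and the argmin set is nonempty
    (hC3a : BddBelow (pibar '' Xbar)) (hC3b : Xstar.Nonempty)
    -- (C5): for every sequence in X̄, `liminf (π̂(x_n) + ε_n(x_n)) > -∞`
    (hC5 : ∀ x : ℕ → M, (∀ n, x n ∈ Xbar) →
      ⊥ < Filter.liminf (fun n => ((pihat (x n) + eps n (x n) : ℝ) : EReal)) atTop)
    -- (C6): local uniform vanishing of the error terms near each optimizer
    (hC6 : ∀ x ∈ Xstar, ∃ δ > 0, ∀ η > 0, ∀ᶠ n in atTop,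
      ∀ y ∈ Xbar, dist x y < δ → |eps n y| ≤ η)
    -- the prescription `x̄*`: an optimizer of the limiting problem minimizing `π̂`
    (xbarstar : M) (hxbarstar : xbarstar ∈ Xstar)
    (hxbarhat : ∀ y ∈ Xstar, pihat xbarstar ≤ pihat y)
    -- the exact optimizers `x_n*`
    (xs : ℕ → M) (hxs : ∀ n, xs n ∈ Xn n)
    (hxsopt : ∀ n, ∀ y ∈ Xn n, F n (xs n) ≤ F n y) :
    Tendsto (fun n => (F n (xs n) - a n) / b n) atTop (𝓝 (sInf (pibar '' Xbar))) := by
  subst hXbar hXstar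
  obtain ⟨hmem, hmin⟩ := hxbarstar
  have hsInf : sInf (pibar '' ⋃ n, Xn n) = pibar xbarstar :=
    IsLeast.csInf_eq ⟨mem_image_of_mem _ hmem, forall_mem_image.2 hmin⟩
  rw [hsInf]
  have hxsmem : ∀ n, xs n ∈ ⋃ n, Xn n := fun n => mem_iUnion.2 ⟨n, hxs n⟩
  obtain ⟨c, -, hc⟩ := EReal.lt_iff_exists_real_btwn.1 (hC5 xs hxsmem)
  have hlow : ∀ᶠ n in atTop, c < pihat (xs n) + eps n (xs n) :=
    (eventually_lt_of_lt_liminf hc).mono fun n hn => EReal.coe_lt_coe_iff.1 hn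
  obtain ⟨δ, hδ, heps⟩ := hC6 xbarstar ⟨hmem, hmin⟩
  obtain ⟨N, hN⟩ := mem_iUnion.1 hmem
  have hlim (k : ℝ) : Tendsto (fun n => pibar xbarstar + k / b n) atTop (𝓝 (pibar xbarstar)) := by
    simpa using (hbtop.const_div_atTop k).const_add (pibar xbarstar)
  refine tendsto_of_tendsto_of_tendsto_of_le_of_le' (hlim c) (hlim (pihat xbarstar + 1)) ?_ ?_
  · filter_upwards [hlow] with n hn
    have hb := hbpos n
    rw [le_div_iff₀ hb, add_mul, div_mul_cancel₀ _ hb.ne', hF n _ (hxs n)]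
    linarith [mul_le_mul_of_nonneg_left (hmin _ (hxsmem n)) hb.le]
  · filter_upwards [heps 1 one_pos, eventually_ge_atTop N] with n hn hNn
    have hb := hbpos n
    have hx := monotone_nat_of_le_succ hmono hNn hN
    have hle := hxsopt n _ hx
    rw [hF n _ hx] at hle
    have habs := le_of_abs_le (hn _ hmem (by simpa using hδ))
    rw [div_le_iff₀ hb, add_mul, div_mul_cancel₀ _ hb.ne']
    linarith
end

section
/- Assume condition (C6). Then limsup_{n→∞} (F_n(x_n*) - a_n)/b_n ≤ π̄(x̄*). -/
open Filter Topology Set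

/-- Under condition (C6), `limsup_{n→∞} (F_n(x_n*) - a_n)/b_n ≤ π̄(x̄*)`
(the limsup is taken in the extended reals). -/
theorem normalized_optimal_value_limsup_le
    {M : Type*} [MetricSpace M]
    (Xn : ℕ → Set M) (hne : ∀ n, (Xn n).Nonempty)
    (hmono : ∀ n, Xn n ⊆ Xn (n + 1))
    (Xbar : Set M) (hXbar : Xbar = ⋃ n, Xn n)
    (a b : ℕ → ℝ) (hbpos : ∀ n, 0 < b n) (hbtop : Tendsto b atTop atTop)
    (pibar pihat : M → ℝ) (eps : ℕ → M → ℝ)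
    (F : ℕ → M → ℝ)
    (hF : ∀ n, ∀ x ∈ Xn n, F n x = a n + b n * pibar x + pihat x + eps n x)
    (Xstar : Set M)
    (hXstar : Xstar = {x ∈ Xbar | ∀ y ∈ Xbar, pibar x ≤ pibar y})
    -- (C3): `inf_{x ∈ X̄} π̄(x) > -∞` and the argmin set is nonempty
    (hC3a : BddBelow (pibar '' Xbar)) (hC3b : Xstar.Nonempty)
    -- (C6): local uniform vanishing of the error terms near each optimizer
    (hC6 : ∀ x ∈ Xstar, ∃ δ > 0, ∀ η > 0, ∀ᶠ n in atTop,
      ∀ y ∈ Xbar, dist x y < δ → |eps n y| ≤ η)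
    -- the prescription `x̄*`: an optimizer of the limiting problem minimizing `π̂`
    (xbarstar : M) (hxbarstar : xbarstar ∈ Xstar)
    (hxbarhat : ∀ y ∈ Xstar, pihat xbarstar ≤ pihat y)
    -- the exact optimizers `x_n*`
    (xs : ℕ → M) (hxs : ∀ n, xs n ∈ Xn n)
    (hxsopt : ∀ n, ∀ y ∈ Xn n, F n (xs n) ≤ F n y) :
    Filter.limsup (fun n => (((F n (xs n) - a n) / b n : ℝ) : EReal)) atTop
      ≤ (pibar xbarstar : EReal) := by
  have hmem : xbarstar ∈ Xbar := by
    rw [hXstar] at hxbarstar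
    exact hxbarstar.1
  obtain ⟨N, hN⟩ : ∃ N, xbarstar ∈ Xn N := by
    rw [hXbar] at hmem
    exact mem_iUnion.1 hmem
  obtain ⟨δ, hδ, hsmall⟩ := hC6 xbarstar hxbarstar
  have hbound : ∀ᶠ n in atTop,
      (F n (xs n) - a n) / b n ≤ pibar xbarstar + (pihat xbarstar + 1) / b n := by
    filter_upwards [hsmall 1 one_pos, eventually_ge_atTop N] with n heps hn
    have hx : xbarstar ∈ Xn n := monotone_nat_of_le_succ hmono hn hN
    have hopt := hxsopt n xbarstar hx
    rw [hF n xbarstar hx] at hopt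
    have he := (abs_le.1 (heps xbarstar hmem (by rwa [dist_self]))).2
    have hb := hbpos n
    have hsplit : pibar xbarstar + (pihat xbarstar + 1) / b n
        = (b n * pibar xbarstar + (pihat xbarstar + 1)) / b n := by
      field_simp
    rw [hsplit]
    gcongr
    linarith
  have hlim : Tendsto (fun n => pibar xbarstar + (pihat xbarstar + 1) / b n) atTop
      (𝓝 (pibar xbarstar)) := by
    simpa using tendsto_const_nhds.add (hbtop.const_div_atTop (pihat xbarstar + 1))
  rw [← (EReal.tendsto_coe.2 hlim).limsup_eq]
  exact limsup_le_limsup (hbound.mono fun n hn => EReal.coe_le_coe_iff.2 hn)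
end

section
/- Assume conditions (C3), (C5) and (C6). Then the sequence b_n·(π̄(x_n*) - inf_{x ∈ X̄} π̄(x)) is bounded above, and consequently π̄(x_n*) → inf_{x ∈ X̄} π̄(x) as n → ∞. -/
open Filter Topology Set

/-- Under conditions (C3), (C5) and (C6), the sequence
`b_n·(π̄(x_n*) - inf_{x ∈ X̄} π̄(x))` is bounded above, and consequently
`π̄(x_n*) → inf_{x ∈ X̄} π̄(x)` as `n → ∞`. -/
theorem limiting_objective_at_exact_optimizers
    {M : Type*} [MetricSpace M]
    (Xn : ℕ → Set M) (hne : ∀ n, (Xn n).Nonempty)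
    (hmono : ∀ n, Xn n ⊆ Xn (n + 1))
    (Xbar : Set M) (hXbar : Xbar = ⋃ n, Xn n)
    (a b : ℕ → ℝ) (hbpos : ∀ n, 0 < b n) (hbtop : Tendsto b atTop atTop)
    (pibar pihat : M → ℝ) (eps : ℕ → M → ℝ)
    (F : ℕ → M → ℝ)
    (hF : ∀ n, ∀ x ∈ Xn n, F n x = a n + b n * pibar x + pihat x + eps n x)
    (Xstar : Set M)
    (hXstar : Xstar = {x ∈ Xbar | ∀ y ∈ Xbar, pibar x ≤ pibar y})
    -- (C3): `inf_{x ∈ X̄} π̄(x) > -∞` and the argmin set is nonempty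
    (hC3a : BddBelow (pibar '' Xbar)) (hC3b : Xstar.Nonempty)
    -- (C5): for every sequence in X̄, `liminf (π̂(x_n) + ε_n(x_n)) > -∞`
    (hC5 : ∀ x : ℕ → M, (∀ n, x n ∈ Xbar) →
      ⊥ < Filter.liminf (fun n => ((pihat (x n) + eps n (x n) : ℝ) : EReal)) atTop)
    -- (C6): local uniform vanishing of the error terms near each optimizer
    (hC6 : ∀ x ∈ Xstar, ∃ δ > 0, ∀ η > 0, ∀ᶠ n in atTop,
      ∀ y ∈ Xbar, dist x y < δ → |eps n y| ≤ η)
    -- the prescription `x̄*`: an optimizer of the limiting problem minimizing `π̂`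
    (xbarstar : M) (hxbarstar : xbarstar ∈ Xstar)
    (hxbarhat : ∀ y ∈ Xstar, pihat xbarstar ≤ pihat y)
    -- the exact optimizers `x_n*`
    (xs : ℕ → M) (hxs : ∀ n, xs n ∈ Xn n)
    (hxsopt : ∀ n, ∀ y ∈ Xn n, F n (xs n) ≤ F n y) :
    (∃ C : ℝ, ∀ n, b n * (pibar (xs n) - sInf (pibar '' Xbar)) ≤ C) ∧
      Tendsto (fun n => pibar (xs n)) atTop (𝓝 (sInf (pibar '' Xbar))) := by
  have hmem : ∀ n, xs n ∈ Xbar := fun n => hXbar ▸ mem_iUnion.2 ⟨n, hxs n⟩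
  have hx := hxbarstar
  rw [hXstar] at hx
  obtain ⟨hxmem, hxmin⟩ := hx
  have hinf : sInf (pibar '' Xbar) = pibar xbarstar :=
    IsLeast.csInf_eq ⟨mem_image_of_mem _ hxmem, forall_mem_image.2 hxmin⟩
  rw [hinf]
  have hmono' : Monotone Xn := monotone_nat_of_le_succ hmono
  obtain ⟨N, hN⟩ : ∃ N, xbarstar ∈ Xn N := by
    rw [hXbar] at hxmem
    exact mem_iUnion.1 hxmem
  obtain ⟨c, -, hc⟩ := EReal.lt_iff_exists_real_btwn.1 (hC5 xs hmem)
  obtain ⟨δ, hδ, hε⟩ := hC6 xbarstar hxbarstar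
  have hev : ∀ᶠ n in atTop,
      b n * (pibar (xs n) - pibar xbarstar) ≤ pihat xbarstar + 1 - c := by
    filter_upwards [eventually_lt_of_lt_liminf hc, hε 1 one_pos, eventually_ge_atTop N]
      with n hcn hεn hn
    have hxn : xbarstar ∈ Xn n := hmono' hn hN
    have hopt := hxsopt n xbarstar hxn
    rw [hF n _ (hxs n), hF n _ hxn] at hopt
    have hlow : c < pihat (xs n) + eps n (xs n) := EReal.coe_lt_coe_iff.1 hcn
    have herr := (abs_le.1 (hεn xbarstar hxmem (by simpa using hδ))).2
    linarith
  obtain ⟨C, hC⟩ := (isBoundedUnder_of_eventually_le hev).bddAbove_range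
  replace hC := forall_mem_range.1 hC
  refine ⟨⟨C, hC⟩, ?_⟩
  have hlim : Tendsto (fun n => pibar xbarstar + C / b n) atTop (𝓝 (pibar xbarstar)) := by
    simpa using (hbtop.const_div_atTop C).const_add (pibar xbarstar)
  refine tendsto_of_tendsto_of_tendsto_of_le_of_le tendsto_const_nhds hlim
    (fun n => hxmin _ (hmem n)) fun n => ?_
  rw [← sub_le_iff_le_add', le_div_iff₀' (hbpos n)]
  exact hC n
end

section
/- Assume conditions (C3), (C5) and (C6), and suppose π̄ is lower semicontinuous at a point x ∈ X̄ that is a cluster point (limit of some subsequence in the metric d) of the sequence (x_n*). Then x is an optimizer of the limiting problem, i.e., x ∈ X̄* = argmin_{y ∈ X̄} π̄(y). -/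
open Filter Topology Set

/-- Under conditions (C3), (C5) and (C6), if `π̄` is lower semicontinuous
(within `X̄`) at a point `x ∈ X̄` that is a cluster point of the sequence `(x_n*)`,
then `x` is an optimizer of the limiting problem, i.e. `x ∈ X̄* = argmin_{y ∈ X̄} π̄(y)`. -/
theorem cluster_points_are_limiting_optimizers
    {M : Type*} [MetricSpace M]
    (Xn : ℕ → Set M) (hne : ∀ n, (Xn n).Nonempty)
    (hmono : ∀ n, Xn n ⊆ Xn (n + 1))
    (Xbar : Set M) (hXbar : Xbar = ⋃ n, Xn n)
    (a b : ℕ → ℝ) (hbpos : ∀ n, 0 < b n) (hbtop : Tendsto b atTop atTop)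
    (pibar pihat : M → ℝ) (eps : ℕ → M → ℝ)
    (F : ℕ → M → ℝ)
    (hF : ∀ n, ∀ x ∈ Xn n, F n x = a n + b n * pibar x + pihat x + eps n x)
    (Xstar : Set M)
    (hXstar : Xstar = {x ∈ Xbar | ∀ y ∈ Xbar, pibar x ≤ pibar y})
    -- (C3): `inf_{x ∈ X̄} π̄(x) > -∞` and the argmin set is nonempty
    (hC3a : BddBelow (pibar '' Xbar)) (hC3b : Xstar.Nonempty)
    -- (C5): for every sequence in X̄, `liminf (π̂(x_n) + ε_n(x_n)) > -∞`
    (hC5 : ∀ x : ℕ → M, (∀ n, x n ∈ Xbar) →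
      ⊥ < Filter.liminf (fun n => ((pihat (x n) + eps n (x n) : ℝ) : EReal)) atTop)
    -- (C6): local uniform vanishing of the error terms near each optimizer
    (hC6 : ∀ x ∈ Xstar, ∃ δ > 0, ∀ η > 0, ∀ᶠ n in atTop,
      ∀ y ∈ Xbar, dist x y < δ → |eps n y| ≤ η)
    -- the prescription `x̄*`: an optimizer of the limiting problem minimizing `π̂`
    (xbarstar : M) (hxbarstar : xbarstar ∈ Xstar)
    (hxbarhat : ∀ y ∈ Xstar, pihat xbarstar ≤ pihat y)
    -- the exact optimizers `x_n*`
    (xs : ℕ → M) (hxs : ∀ n, xs n ∈ Xn n)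
    (hxsopt : ∀ n, ∀ y ∈ Xn n, F n (xs n) ≤ F n y)
    -- `x` is a cluster point of `(x_n*)` lying in `X̄` at which `π̄` is l.s.c.
    (x : M) (hx : x ∈ Xbar)
    (hlsc : LowerSemicontinuousWithinAt pibar Xbar x)
    (φ : ℕ → ℕ) (hφ : StrictMono φ)
    (hconv : Tendsto (fun k => xs (φ k)) atTop (𝓝 x)) :
    x ∈ Xstar := by
  have hmono' : Monotone Xn := monotone_nat_of_le_succ hmono
  have hsub : ∀ n, Xn n ⊆ Xbar := fun n => hXbar ▸ subset_iUnion Xn n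
  have hz := hxbarstar
  rw [hXstar] at hz
  obtain ⟨hzX, hzmin⟩ := hz
  obtain ⟨N, hN⟩ := mem_iUnion.1 (hXbar ▸ hzX)
  obtain ⟨C, -, hC⟩ := EReal.lt_iff_exists_real_btwn.1 (hC5 xs fun n => hsub n (hxs n))
  obtain ⟨δ, hδ, hε⟩ := hC6 xbarstar hxbarstar
  have hbound : ∀ᶠ n in atTop,
      b n * (pibar (xs n) - pibar xbarstar) ≤ pihat xbarstar + 1 - C := by
    filter_upwards [eventually_ge_atTop N, hε 1 one_pos, eventually_lt_of_lt_liminf hC]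
      with n hn hεn hCn
    have hzn := hmono' hn hN
    have hopt := hxsopt n xbarstar hzn
    rw [hF n _ (hxs n), hF n _ hzn] at hopt
    have hεz := (abs_le.1 (hεn xbarstar hzX (by simpa using hδ))).2
    have hCn' := EReal.coe_lt_coe_iff.1 hCn
    linarith
  suffices hle : pibar x ≤ pibar xbarstar by
    rw [hXstar]
    exact ⟨hx, fun y hy => hle.trans (hzmin y hy)⟩
  by_contra! hlt
  obtain ⟨c, hzc, hcx⟩ := exists_between hlt
  have hwithin : Tendsto (fun k => xs (φ k)) atTop (𝓝[Xbar] x) :=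
    tendsto_nhdsWithin_iff.2 ⟨hconv, Eventually.of_forall fun k => hsub _ (hxs (φ k))⟩
  have hbig : Tendsto (fun k => b (φ k) * (c - pibar xbarstar)) atTop atTop :=
    (hbtop.comp hφ.tendsto_atTop).atTop_mul_const (sub_pos.2 hzc)
  obtain ⟨k, hk₁, hk₂, hk₃⟩ := ((hwithin.eventually (hlsc c hcx)).and
    ((hφ.tendsto_atTop.eventually hbound).and
      (hbig.eventually_gt_atTop (pihat xbarstar + 1 - C)))).exists
  have hmul := mul_le_mul_of_nonneg_left (sub_le_sub_right hk₁.le (pibar xbarstar))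
    (hbpos (φ k)).le
  linarith
end

section
/- Assume conditions (C3), (C4), (C5) and (C6), and suppose a subsequence (x_{n_k}*) converges in the metric d to a point x̄ ∈ X̄*. Then limsup_{k→∞} [ F_{n_k}(x̄*) - F_{n_k}(x_{n_k}*) ] ≤ π̂(x̄*) - π̂(x̄) ≤ 0, and hence F_{n_k}(x̄*) - F_{n_k}(x_{n_k}*) → 0 as k → ∞. -/
open Filter Topology Set

/-- If the functions `e n` tend to zero uniformly on the part of `s` within distance `δ` of `x`,
then they tend to zero along every sequence of `s` that converges to `x`. -/
theorem tendsto_zero_along_of_locally_uniform {M : Type*} [MetricSpace M] {s : Set M}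
    {e : ℕ → M → ℝ} {x : M}
    (he : ∃ δ > 0, ∀ η > 0, ∀ᶠ n in atTop, ∀ y ∈ s, dist x y < δ → |e n y| ≤ η)
    {φ : ℕ → ℕ} (hφ : Tendsto φ atTop atTop) {y : ℕ → M} (hys : ∀ k, y k ∈ s)
    (hy : Tendsto y atTop (𝓝 x)) :
    Tendsto (fun k => e (φ k) (y k)) atTop (𝓝 0) := by
  obtain ⟨δ, hδ, h⟩ := he
  refine Metric.nhds_basis_closedBall.tendsto_right_iff.2 fun η hη => ?_
  filter_upwards [hφ.eventually (h η hη), hy.eventually (Metric.ball_mem_nhds x hδ)]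
    with k hk hyk
  simpa [Real.dist_eq] using hk (y k) (hys k) (by simpa [dist_comm] using hyk)

/-- Under conditions (C3)--(C6), if a subsequence `(x_{n_k}*)` converges to
`x̄ ∈ X̄*`, then `limsup_{k→∞} [F_{n_k}(x̄*) - F_{n_k}(x_{n_k}*)] ≤ π̂(x̄*) - π̂(x̄) ≤ 0`,
and hence `F_{n_k}(x̄*) - F_{n_k}(x_{n_k}*) → 0` as `k → ∞`. -/
theorem optimality_gap_along_convergent_subsequence
    {M : Type*} [MetricSpace M]
    (Xn : ℕ → Set M) (hne : ∀ n, (Xn n).Nonempty)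
    (hmono : ∀ n, Xn n ⊆ Xn (n + 1))
    (Xbar : Set M) (hXbar : Xbar = ⋃ n, Xn n)
    (a b : ℕ → ℝ) (hbpos : ∀ n, 0 < b n) (hbtop : Tendsto b atTop atTop)
    (pibar pihat : M → ℝ) (eps : ℕ → M → ℝ)
    (F : ℕ → M → ℝ)
    (hF : ∀ n, ∀ x ∈ Xn n, F n x = a n + b n * pibar x + pihat x + eps n x)
    (Xstar : Set M)
    (hXstar : Xstar = {x ∈ Xbar | ∀ y ∈ Xbar, pibar x ≤ pibar y})
    -- (C3): `inf_{x ∈ X̄} π̄(x) > -∞` and the argmin set is nonempty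
    (hC3a : BddBelow (pibar '' Xbar)) (hC3b : Xstar.Nonempty)
    -- (C4): `π̂` is continuous (within `X̄`) at every point of `X̄*`
    (hC4 : ∀ x ∈ Xstar, ContinuousWithinAt pihat Xbar x)
    -- (C5): for every sequence in X̄, `liminf (π̂(x_n) + ε_n(x_n)) > -∞`
    (hC5 : ∀ x : ℕ → M, (∀ n, x n ∈ Xbar) →
      ⊥ < Filter.liminf (fun n => ((pihat (x n) + eps n (x n) : ℝ) : EReal)) atTop)
    -- (C6): local uniform vanishing of the error terms near each optimizer
    (hC6 : ∀ x ∈ Xstar, ∃ δ > 0, ∀ η > 0, ∀ᶠ n in atTop,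
      ∀ y ∈ Xbar, dist x y < δ → |eps n y| ≤ η)
    -- the prescription `x̄*`: an optimizer of the limiting problem minimizing `π̂`
    (xbarstar : M) (hxbarstar : xbarstar ∈ Xstar)
    (hxbarhat : ∀ y ∈ Xstar, pihat xbarstar ≤ pihat y)
    -- the exact optimizers `x_n*`
    (xs : ℕ → M) (hxs : ∀ n, xs n ∈ Xn n)
    (hxsopt : ∀ n, ∀ y ∈ Xn n, F n (xs n) ≤ F n y)
    -- a subsequence of `(x_n*)` converging to `x̄ ∈ X̄*`
    (xcl : M) (hxcl : xcl ∈ Xstar)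
    (nk : ℕ → ℕ) (hnk : StrictMono nk)
    (hconv : Tendsto (fun k => xs (nk k)) atTop (𝓝 xcl)) :
    (Filter.limsup
        (fun k => ((F (nk k) xbarstar - F (nk k) (xs (nk k)) : ℝ) : EReal)) atTop
        ≤ ((pihat xbarstar - pihat xcl : ℝ) : EReal)) ∧
      pihat xbarstar - pihat xcl ≤ 0 ∧
      Tendsto (fun k => F (nk k) xbarstar - F (nk k) (xs (nk k))) atTop (𝓝 0) := by
  have hsub : ∀ n, Xn n ⊆ Xbar := fun n => hXbar ▸ subset_iUnion Xn n
  have hφ := hnk.tendsto_atTop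
  have hstar := hxbarstar
  rw [hXstar] at hstar
  obtain ⟨hstar_mem, hstar_min⟩ := hstar
  have hmem : ∀ᶠ k in atTop, xbarstar ∈ Xn (nk k) := by
    rw [hXbar, mem_iUnion] at hstar_mem
    obtain ⟨N, hN⟩ := hstar_mem
    filter_upwards [hφ.eventually_ge_atTop N] with k hk
    exact monotone_nat_of_le_succ hmono hk hN
  have hxs_mem : ∀ k, xs (nk k) ∈ Xbar := fun k => hsub _ (hxs _)
  have heps_xs : Tendsto (fun k => eps (nk k) (xs (nk k))) atTop (𝓝 0) :=
    tendsto_zero_along_of_locally_uniform (hC6 xcl hxcl) hφ hxs_mem hconv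
  have heps_star : Tendsto (fun k => eps (nk k) xbarstar) atTop (𝓝 0) :=
    tendsto_zero_along_of_locally_uniform (hC6 xbarstar hxbarstar) hφ
      (fun _ => hstar_mem) tendsto_const_nhds
  have hpihat : Tendsto (fun k => pihat (xs (nk k))) atTop (𝓝 (pihat xcl)) :=
    (hC4 xcl hxcl).tendsto.comp
      (tendsto_nhdsWithin_iff.2 ⟨hconv, Eventually.of_forall hxs_mem⟩)
  have hbound : Tendsto (fun k => pihat xbarstar - pihat (xs (nk k)) +
      (eps (nk k) xbarstar - eps (nk k) (xs (nk k)))) atTop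
      (𝓝 (pihat xbarstar - pihat xcl)) := by
    simpa using (hpihat.const_sub (pihat xbarstar)).add (heps_star.sub heps_xs)
  have hgap_nonneg : ∀ᶠ k in atTop, 0 ≤ F (nk k) xbarstar - F (nk k) (xs (nk k)) := by
    filter_upwards [hmem] with k hk
    exact sub_nonneg.2 (hxsopt _ _ hk)
  have hgap_le : ∀ᶠ k in atTop, F (nk k) xbarstar - F (nk k) (xs (nk k)) ≤
      pihat xbarstar - pihat (xs (nk k)) +
        (eps (nk k) xbarstar - eps (nk k) (xs (nk k))) := by
    filter_upwards [hmem] with k hk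
    rw [hF _ _ hk, hF _ _ (hxs _)]
    linarith [mul_le_mul_of_nonneg_left (hstar_min _ (hxs_mem k)) (hbpos (nk k)).le]
  have hle : pihat xbarstar - pihat xcl ≤ 0 := sub_nonpos.2 (hxbarhat xcl hxcl)
  have hge : 0 ≤ pihat xbarstar - pihat xcl :=
    ge_of_tendsto hbound (hgap_nonneg.mp (hgap_le.mono fun _ h h' => h'.trans h))
  have hgap : Tendsto (fun k => F (nk k) xbarstar - F (nk k) (xs (nk k))) atTop (𝓝 0) :=
    tendsto_of_tendsto_of_tendsto_of_le_of_le' tendsto_const_nhds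
      (le_antisymm hle hge ▸ hbound) hgap_nonneg hgap_le
  refine ⟨?_, hle, hgap⟩
  rw [(EReal.tendsto_coe.2 hgap).limsup_eq]
  exact EReal.coe_le_coe_iff.2 hge
end

section
/- (Main Theorem: o(1)-optimality of the asymptotically-derived prescription.) Assume conditions (C3), (C4), (C5), (C6) and the regularity condition (C7). Then the prescription x̄* is o(1)-optimal for the original optimization problems, i.e., F_n(x̄*) - F_n(x_n*) → 0 as n → ∞ (equivalently, Π_n(g_n(x̄*)) - Π_n* → 0). -/
open Filter Topology Set

/-- Main Theorem: Under conditions (C3)--(C7), the prescription `x̄*` is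
`o(1)`-optimal for the original optimization problems:
`F_n(x̄*) - F_n(x_n*) → 0` as `n → ∞` (i.e. `Π_n(g_n(x̄*)) - Π_n* → 0`). -/
theorem asymptotic_prescription_is_o1_optimal
    {M : Type*} [MetricSpace M]
    (Xn : ℕ → Set M) (hne : ∀ n, (Xn n).Nonempty)
    (hmono : ∀ n, Xn n ⊆ Xn (n + 1))
    (Xbar : Set M) (hXbar : Xbar = ⋃ n, Xn n)
    (a b : ℕ → ℝ) (hbpos : ∀ n, 0 < b n) (hbtop : Tendsto b atTop atTop)
    (pibar pihat : M → ℝ) (eps : ℕ → M → ℝ)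
    (F : ℕ → M → ℝ)
    (hF : ∀ n, ∀ x ∈ Xn n, F n x = a n + b n * pibar x + pihat x + eps n x)
    (Xstar : Set M)
    (hXstar : Xstar = {x ∈ Xbar | ∀ y ∈ Xbar, pibar x ≤ pibar y})
    -- (C3): `inf_{x ∈ X̄} π̄(x) > -∞` and the argmin set is nonempty
    (hC3a : BddBelow (pibar '' Xbar)) (hC3b : Xstar.Nonempty)
    -- (C4): `π̂` is continuous (within `X̄`) at every point of `X̄*`
    (hC4 : ∀ x ∈ Xstar, ContinuousWithinAt pihat Xbar x)
    -- (C5): for every sequence in X̄, `liminf (π̂(x_n) + ε_n(x_n)) > -∞`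
    (hC5 : ∀ x : ℕ → M, (∀ n, x n ∈ Xbar) →
      ⊥ < Filter.liminf (fun n => ((pihat (x n) + eps n (x n) : ℝ) : EReal)) atTop)
    -- (C6): local uniform vanishing of the error terms near each optimizer
    (hC6 : ∀ x ∈ Xstar, ∃ δ > 0, ∀ η > 0, ∀ᶠ n in atTop,
      ∀ y ∈ Xbar, dist x y < δ → |eps n y| ≤ η)
    -- (C7): minimizing sequences of `π̄` have subsequences converging to points of `X̄*`
    (hC7 : ∀ y : ℕ → M, (∀ k, y k ∈ Xbar) →
      Tendsto (fun k => pibar (y k)) atTop (𝓝 (sInf (pibar '' Xbar))) →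
      ∃ x ∈ Xstar, ∃ φ : ℕ → ℕ, StrictMono φ ∧
        Tendsto (fun k => y (φ k)) atTop (𝓝 x))
    -- the prescription `x̄*`: an optimizer of the limiting problem minimizing `π̂`
    (xbarstar : M) (hxbarstar : xbarstar ∈ Xstar)
    (hxbarhat : ∀ y ∈ Xstar, pihat xbarstar ≤ pihat y)
    -- the exact optimizers `x_n*`
    (xs : ℕ → M) (hxs : ∀ n, xs n ∈ Xn n)
    (hxsopt : ∀ n, ∀ y ∈ Xn n, F n (xs n) ≤ F n y) :
    Tendsto (fun n => F n xbarstar - F n (xs n)) atTop (𝓝 0) := by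
  have hsub : ∀ n, Xn n ⊆ Xbar := fun n => hXbar ▸ subset_iUnion Xn n
  have hstar : ∀ x ∈ Xstar, x ∈ Xbar ∧ ∀ y ∈ Xbar, pibar x ≤ pibar y := by
    intro x hx
    rwa [hXstar] at hx
  obtain ⟨hmem, hmin⟩ := hstar xbarstar hxbarstar
  have hinf : sInf (pibar '' Xbar) = pibar xbarstar :=
    IsLeast.csInf_eq ⟨mem_image_of_mem _ hmem, forall_mem_image.2 hmin⟩
  have hev : ∀ᶠ n in atTop, xbarstar ∈ Xn n := by
    rw [hXbar] at hmem
    obtain ⟨N, hN⟩ := mem_iUnion.1 hmem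
    filter_upwards [eventually_ge_atTop N] with n hn
    exact monotone_nat_of_le_succ hmono hn hN
  have heps : ∀ x ∈ Xstar, ∀ (ν : ℕ → ℕ) (y : ℕ → M), Tendsto ν atTop atTop →
      (∀ k, y k ∈ Xbar) → Tendsto y atTop (𝓝 x) →
      Tendsto (fun k => eps (ν k) (y k)) atTop (𝓝 0) := by
    intro x hx ν y hν hy hyx
    obtain ⟨δ, hδ, h⟩ := hC6 x hx
    rw [Metric.tendsto_nhds]
    intro η hη
    filter_upwards [hν.eventually (h (η / 2) (half_pos hη)),
      hyx.eventually (Metric.ball_mem_nhds x hδ)] with k hk hyk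
    have := hk (y k) (hy k) (by rw [dist_comm]; exact hyk)
    rw [Real.dist_eq, sub_zero]
    linarith
  have heps0 : Tendsto (fun n => eps n xbarstar) atTop (𝓝 0) :=
    heps xbarstar hxbarstar id (fun _ => xbarstar) tendsto_id (fun _ => hmem) tendsto_const_nhds
  have hnonneg : ∀ᶠ n in atTop, 0 ≤ F n xbarstar - F n (xs n) :=
    hev.mono fun n hn => sub_nonneg.2 (hxsopt n _ hn)
  have hdiff : ∀ᶠ n in atTop, F n xbarstar - F n (xs n) =
      (pihat xbarstar + eps n xbarstar) - (pihat (xs n) + eps n (xs n)) -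
        b n * (pibar (xs n) - pibar xbarstar) := by
    filter_upwards [hev] with n hn
    rw [hF n _ hn, hF n _ (hxs n)]
    ring
  obtain ⟨c, hc⟩ : ∃ c : ℝ, ∀ᶠ n in atTop, c ≤ pihat (xs n) + eps n (xs n) := by
    obtain ⟨c, -, hc⟩ := EReal.lt_iff_exists_real_btwn.1 (hC5 xs fun n => hsub n (hxs n))
    exact ⟨c, (eventually_lt_of_lt_liminf hc).mono fun n hn => (EReal.coe_lt_coe_iff.1 hn).le⟩
  have hpibar : Tendsto (fun n => pibar (xs n)) atTop (𝓝 (pibar xbarstar)) := by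
    have hlim : Tendsto (fun n => pibar xbarstar + (pihat xbarstar + 1 - c) / b n) atTop
        (𝓝 (pibar xbarstar)) := by
      simpa using (hbtop.const_div_atTop (pihat xbarstar + 1 - c)).const_add (pibar xbarstar)
    refine tendsto_of_tendsto_of_tendsto_of_le_of_le' tendsto_const_nhds hlim
      (Eventually.of_forall fun n => hmin _ (hsub n (hxs n))) ?_
    filter_upwards [hc, hdiff, hnonneg, heps0.eventually_le_const one_pos] with n h1 h2 h3 h4
    have : pibar (xs n) - pibar xbarstar ≤ (pihat xbarstar + 1 - c) / b n := by
      rw [le_div_iff₀ (hbpos n)]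
      linarith
    linarith
  refine tendsto_of_subseq_tendsto fun ν hν => ?_
  obtain ⟨x, hx, φ, hφ, hlim⟩ := hC7 (fun k => xs (ν k)) (fun k => hsub _ (hxs _))
    (hinf ▸ hpibar.comp hν)
  refine ⟨φ, ?_⟩
  have hνφ : Tendsto (fun k => ν (φ k)) atTop atTop := hν.comp hφ.tendsto_atTop
  have hpihat : Tendsto (fun k => pihat (xs (ν (φ k)))) atTop (𝓝 (pihat x)) :=
    Tendsto.comp (hC4 x hx) (tendsto_nhdsWithin_iff.2
      ⟨hlim, Eventually.of_forall fun k => hsub _ (hxs _)⟩)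
  have hbound : Tendsto (fun k => (pihat xbarstar + eps (ν (φ k)) xbarstar) -
      (pihat (xs (ν (φ k))) + eps (ν (φ k)) (xs (ν (φ k))))) atTop
      (𝓝 (pihat xbarstar - pihat x)) := by
    simpa using ((heps0.comp hνφ).const_add (pihat xbarstar)).sub
      (hpihat.add (heps x hx _ _ hνφ (fun k => hsub _ (hxs _)) hlim))
  have hle : ∀ᶠ k in atTop, F (ν (φ k)) xbarstar - F (ν (φ k)) (xs (ν (φ k))) ≤
      (pihat xbarstar + eps (ν (φ k)) xbarstar) -
        (pihat (xs (ν (φ k))) + eps (ν (φ k)) (xs (ν (φ k)))) := by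
    filter_upwards [hνφ.eventually hdiff] with k hk
    rw [hk]
    exact sub_le_self _ (mul_nonneg (hbpos _).le (sub_nonneg.2 (hmin _ (hsub _ (hxs _)))))
  have hnonneg' := hνφ.eventually hnonneg
  have hzero : pihat xbarstar - pihat x = 0 :=
    le_antisymm (sub_nonpos.2 (hxbarhat x hx))
      (ge_of_tendsto hbound (hnonneg'.and hle |>.mono fun k hk => hk.1.trans hk.2))
  rw [hzero] at hbound
  exact tendsto_of_tendsto_of_tendsto_of_le_of_le' tendsto_const_nhds hbound hnonneg' hle
end

section
/- (Generalization of the main theorem: o(c_n)-optimality.) Suppose the reparametrized objectives have the form F_n(x) = a_n + b_n·π̄(x) + c_n·(π̂(x) + ε_n(x)) for x ∈ X̄_n, where c_n > 0 and c_n/b_n → 0 as n → ∞, and assume conditions (C3), (C4), (C5), (C6) and (C7). Then the prescription x̄* is o(c_n)-optimal: (F_n(x̄*) - F_n(x_n*))/c_n → 0 as n → ∞. -/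
open Filter Topology Set

/-- A real sequence whose `EReal`-valued limit inferior is not `⊥` is eventually bounded below. -/
theorem exists_eventually_ge_of_bot_lt_liminf {ι : Type*} {l : Filter ι} {u : ι → ℝ}
    (h : ⊥ < Filter.liminf (fun i => (u i : EReal)) l) : ∃ K : ℝ, ∀ᶠ i in l, K ≤ u i := by
  obtain ⟨K, -, hK⟩ := EReal.lt_iff_exists_real_btwn.1 h
  exact ⟨K, (eventually_lt_of_lt_liminf hK).mono fun i hi => (EReal.coe_lt_coe_iff.1 hi).le⟩

/-- If `f n` tends to zero uniformly on a neighbourhood of `x` within `s`, then it tends to zero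
along every sequence in `s` converging to `x`. -/
theorem tendsto_zero_of_locally_uniform {ι M : Type*} [PseudoMetricSpace M] {l : Filter ι}
    {s : Set M} {f : ℕ → M → ℝ} {x : M}
    (h : ∃ δ > 0, ∀ η > 0, ∀ᶠ n in atTop, ∀ y ∈ s, dist x y < δ → |f n y| ≤ η)
    {n : ι → ℕ} (hn : Tendsto n l atTop) {y : ι → M} (hys : ∀ i, y i ∈ s)
    (hy : Tendsto y l (𝓝 x)) : Tendsto (fun i => f (n i) (y i)) l (𝓝 0) := by
  obtain ⟨δ, hδ, h⟩ := h
  refine Metric.tendsto_nhds.2 fun η hη => ?_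
  filter_upwards [hn.eventually (h (η / 2) (half_pos hη)), Metric.tendsto_nhds.1 hy δ hδ]
    with i hi hd
  rw [Real.dist_eq, sub_zero]
  exact (hi (y i) (hys i) (by rwa [dist_comm])).trans_lt (half_lt_self hη)

/-- Generalization of the main theorem: with objectives of the form
`F_n(x) = a_n + b_n·π̄(x) + c_n·(π̂(x) + ε_n(x))`, where `c_n > 0` and `c_n/b_n → 0`,
and under conditions (C3)--(C7), the prescription `x̄*` is `o(c_n)`-optimal:
`(F_n(x̄*) - F_n(x_n*))/c_n → 0` as `n → ∞`. -/
theorem asymptotic_prescription_is_ocn_optimal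
    {M : Type*} [MetricSpace M]
    (Xn : ℕ → Set M) (hne : ∀ n, (Xn n).Nonempty)
    (hmono : ∀ n, Xn n ⊆ Xn (n + 1))
    (Xbar : Set M) (hXbar : Xbar = ⋃ n, Xn n)
    (a b c : ℕ → ℝ) (hbpos : ∀ n, 0 < b n) (hbtop : Tendsto b atTop atTop)
    (hcpos : ∀ n, 0 < c n)
    (hcb : Tendsto (fun n => c n / b n) atTop (𝓝 0))
    (pibar pihat : M → ℝ) (eps : ℕ → M → ℝ)
    (F : ℕ → M → ℝ)
    (hF : ∀ n, ∀ x ∈ Xn n, F n x = a n + b n * pibar x + c n * (pihat x + eps n x))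
    (Xstar : Set M)
    (hXstar : Xstar = {x ∈ Xbar | ∀ y ∈ Xbar, pibar x ≤ pibar y})
    -- (C3): `inf_{x ∈ X̄} π̄(x) > -∞` and the argmin set is nonempty
    (hC3a : BddBelow (pibar '' Xbar)) (hC3b : Xstar.Nonempty)
    -- (C4): `π̂` is continuous (within `X̄`) at every point of `X̄*`
    (hC4 : ∀ x ∈ Xstar, ContinuousWithinAt pihat Xbar x)
    -- (C5): for every sequence in X̄, `liminf (π̂(x_n) + ε_n(x_n)) > -∞`
    (hC5 : ∀ x : ℕ → M, (∀ n, x n ∈ Xbar) →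
      ⊥ < Filter.liminf (fun n => ((pihat (x n) + eps n (x n) : ℝ) : EReal)) atTop)
    -- (C6): local uniform vanishing of the error terms near each optimizer
    (hC6 : ∀ x ∈ Xstar, ∃ δ > 0, ∀ η > 0, ∀ᶠ n in atTop,
      ∀ y ∈ Xbar, dist x y < δ → |eps n y| ≤ η)
    -- (C7): minimizing sequences of `π̄` have subsequences converging to points of `X̄*`
    (hC7 : ∀ y : ℕ → M, (∀ k, y k ∈ Xbar) →
      Tendsto (fun k => pibar (y k)) atTop (𝓝 (sInf (pibar '' Xbar))) →
      ∃ x ∈ Xstar, ∃ φ : ℕ → ℕ, StrictMono φ ∧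
        Tendsto (fun k => y (φ k)) atTop (𝓝 x))
    -- the prescription `x̄*`: an optimizer of the limiting problem minimizing `π̂`
    (xbarstar : M) (hxbarstar : xbarstar ∈ Xstar)
    (hxbarhat : ∀ y ∈ Xstar, pihat xbarstar ≤ pihat y)
    -- the exact optimizers `x_n*`
    (xs : ℕ → M) (hxs : ∀ n, xs n ∈ Xn n)
    (hxsopt : ∀ n, ∀ y ∈ Xn n, F n (xs n) ≤ F n y) :
    Tendsto (fun n => (F n xbarstar - F n (xs n)) / c n) atTop (𝓝 0) := by
  subst hXbar hXstar
  have hmono' : Monotone Xn := monotone_nat_of_le_succ hmono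
  have hsub : ∀ n, Xn n ⊆ ⋃ n, Xn n := subset_iUnion Xn
  have hxs' : ∀ n, xs n ∈ ⋃ n, Xn n := fun n => hsub n (hxs n)
  obtain ⟨hxmem, hxmin⟩ := id hxbarstar
  have hev : ∀ᶠ n in atTop, xbarstar ∈ Xn n := by
    obtain ⟨N, hN⟩ := mem_iUnion.1 hxmem
    filter_upwards [eventually_ge_atTop N] with n hn using hmono' hn hN
  have hinf : sInf (pibar '' ⋃ n, Xn n) = pibar xbarstar :=
    IsLeast.csInf_eq ⟨mem_image_of_mem _ hxmem, forall_mem_image.2 hxmin⟩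
  have heps : Tendsto (fun n => eps n xbarstar) atTop (𝓝 0) :=
    tendsto_zero_of_locally_uniform (hC6 _ hxbarstar) tendsto_id (fun _ => hxmem)
      tendsto_const_nhds
  have hgap : ∀ᶠ n in atTop, b n * (pibar (xs n) - pibar xbarstar) ≤
      c n * (pihat xbarstar + eps n xbarstar - (pihat (xs n) + eps n (xs n))) := by
    filter_upwards [hev] with n hn
    have h := hxsopt n _ hn
    rw [hF n _ hn, hF n _ (hxs n)] at h
    linarith
  have hpibar : Tendsto (fun n => pibar (xs n)) atTop (𝓝 (pibar xbarstar)) := by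
    obtain ⟨K, hK⟩ := exists_eventually_ge_of_bot_lt_liminf (hC5 xs hxs')
    have hlim : Tendsto (fun n => pibar xbarstar +
        c n / b n * (pihat xbarstar + eps n xbarstar - K)) atTop (𝓝 (pibar xbarstar)) := by
      simpa using (hcb.mul ((heps.const_add (pihat xbarstar)).sub_const K)).const_add
        (pibar xbarstar)
    refine tendsto_of_tendsto_of_tendsto_of_le_of_le' tendsto_const_nhds hlim
      (Eventually.of_forall fun n => hxmin _ (hxs' n)) ?_
    filter_upwards [hgap, hK] with n hn hKn
    rw [← sub_le_iff_le_add', div_mul_eq_mul_div, le_div_iff₀ (hbpos n), mul_comm]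
    exact hn.trans (mul_le_mul_of_nonneg_left (by linarith) (hcpos n).le)
  refine tendsto_of_subseq_tendsto fun ns hns => ?_
  obtain ⟨x, hx, φ, hφ, hlim⟩ := hC7 (fun k => xs (ns k)) (fun k => hxs' _)
    (hinf ▸ hpibar.comp hns)
  refine ⟨φ, ?_⟩
  have hm : Tendsto (fun k => ns (φ k)) atTop atTop := hns.comp hφ.tendsto_atTop
  have hpihat : Tendsto (fun k => pihat (xs (ns (φ k)))) atTop (𝓝 (pihat x)) :=
    (hC4 x hx).tendsto.comp
      (tendsto_nhdsWithin_iff.2 ⟨hlim, Eventually.of_forall fun _ => hxs' _⟩)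
  have hepsx : Tendsto (fun k => eps (ns (φ k)) (xs (ns (φ k)))) atTop (𝓝 0) :=
    tendsto_zero_of_locally_uniform (hC6 x hx) hm (fun _ => hxs' _) hlim
  have hupper : Tendsto (fun k => eps (ns (φ k)) xbarstar +
      (pihat x - (pihat (xs (ns (φ k))) + eps (ns (φ k)) (xs (ns (φ k)))))) atTop (𝓝 0) := by
    simpa using (heps.comp hm).add ((hpihat.add hepsx).const_sub (pihat x))
  refine tendsto_of_tendsto_of_tendsto_of_le_of_le' tendsto_const_nhds hupper ?_ ?_
  · filter_upwards [hm.eventually hev] with k hk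
    exact div_nonneg (sub_nonneg.2 (hxsopt _ _ hk)) (hcpos _).le
  · filter_upwards [hm.eventually hev] with k hk
    rw [div_le_iff₀ (hcpos _), hF _ _ hk, hF _ _ (hxs _)]
    have hb := mul_le_mul_of_nonneg_left (hxmin _ (hxs' (ns (φ k)))) (hbpos (ns (φ k))).le
    have hc := mul_le_mul_of_nonneg_left (hxbarhat x hx) (hcpos (ns (φ k))).le
    linarith
end

section
/- For any c > 0 and h > 0, the function π̄(x) = c·x + h·q̄(x), where q̄(x) = (1/x)·(1 + x·Φ(x)/φ(x))^{-1} for x ∈ (0,∞), attains its infimum over (0,∞) at a unique point x̄* ∈ (0,∞). -/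
open Filter Topology Set

/-- The standard normal Mills-type ratio `Φ / φ` solves `r' = 1 + x r`. -/
theorem hasDerivAt_gaussian_cdf_div_density {φ Φ : ℝ → ℝ}
    (hφ : ∀ x, φ x = (Real.sqrt (2 * Real.pi))⁻¹ * Real.exp (-(x ^ 2) / 2))
    (hΦ : ∀ x, Φ x = ∫ t in Set.Iic x, φ t) (x : ℝ) :
    HasDerivAt (fun y => Φ y / φ y) (1 + x * (Φ x / φ x)) x := by
  have hpos : 0 < φ x := by rw [hφ]; positivity
  have hφfun : φ = fun x => (Real.sqrt (2 * Real.pi))⁻¹ * Real.exp (-(x ^ 2) / 2) := funext hφ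
  have hcont : Continuous φ := by rw [hφfun]; fun_prop
  have hint : MeasureTheory.Integrable φ := by
    have := (integrable_exp_neg_mul_sq (b := 1 / 2) (by norm_num)).const_mul
      (Real.sqrt (2 * Real.pi))⁻¹
    rw [hφfun]
    convert this using 4
    ring
  have hΦ' : HasDerivAt Φ (φ x) x := by
    have hΦfun : Φ = fun y => (∫ t in (0 : ℝ)..y, φ t) + Φ 0 := by
      funext y
      rw [← intervalIntegral.integral_Iic_sub_Iic hint.integrableOn hint.integrableOn, ← hΦ, ← hΦ]
      ring
    rw [hΦfun]
    exact (intervalIntegral.integral_hasDerivAt_right (hcont.intervalIntegrable _ _)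
      (hcont.stronglyMeasurableAtFilter _ _) hcont.continuousAt).add_const _
  have hφ' : HasDerivAt φ (-x * φ x) x := by
    rw [hφfun]
    refine (((((hasDerivAt_id' x).fun_pow 2).fun_neg.div_const 2).exp).const_mul
      (Real.sqrt (2 * Real.pi))⁻¹).congr_deriv ?_
    simp
    ring
  refine (hΦ'.fun_div hφ' hpos.ne').congr_deriv ?_
  field_simp
  ring

theorem gaussian_cdf_nonneg {φ Φ : ℝ → ℝ}
    (hφ : ∀ x, φ x = (Real.sqrt (2 * Real.pi))⁻¹ * Real.exp (-(x ^ 2) / 2))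
    (hΦ : ∀ x, Φ x = ∫ t in Set.Iic x, φ t) (x : ℝ) : 0 ≤ Φ x := by
  rw [hΦ]
  exact MeasureTheory.integral_nonneg fun t => by rw [hφ]; simp only [Pi.zero_apply]; positivity

/-- If `r ≥ 0` solves `r' = 1 + x r`, then `c x + h / (x + x² r)` is strictly convex on `(0, ∞)`. -/
theorem strictConvexOn_linear_add_inv {c h : ℝ} (hh : 0 < h) {r : ℝ → ℝ} (hr0 : ∀ x, 0 ≤ r x)
    (hr : ∀ x, HasDerivAt r (1 + x * r x) x) :
    StrictConvexOn ℝ (Ioi 0) (fun x => c * x + h * (x + x ^ 2 * r x)⁻¹) := by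
  have hDpos : ∀ x : ℝ, 0 < x → 0 < x + x ^ 2 * r x := fun x hx => by
    have := hr0 x
    positivity
  have hD : ∀ x, HasDerivAt (fun x => x + x ^ 2 * r x)
      (1 + x ^ 2 + (2 * x + x ^ 3) * r x) x := fun x => by
    refine ((hasDerivAt_id' x).fun_add
      (((hasDerivAt_id' x).fun_pow 2).fun_mul (hr x))).congr_deriv ?_
    simp
    ring
  have hD' : ∀ x, HasDerivAt (fun x => 1 + x ^ 2 + (2 * x + x ^ 3) * r x)
      (4 * x + x ^ 3 + (2 + 5 * x ^ 2 + x ^ 4) * r x) x := fun x => by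
    refine ((((hasDerivAt_id' x).fun_pow 2).const_add 1).fun_add
      ((((hasDerivAt_id' x).const_mul 2).fun_add
        ((hasDerivAt_id' x).fun_pow 3)).fun_mul (hr x))).congr_deriv ?_
    simp
    ring
  have hf : ∀ x : ℝ, 0 < x → HasDerivAt (fun x => c * x + h * (x + x ^ 2 * r x)⁻¹)
      (c + h * (-(1 + x ^ 2 + (2 * x + x ^ 3) * r x) / (x + x ^ 2 * r x) ^ 2)) x := fun x hx => by
    refine (((hasDerivAt_id' x).const_mul c).fun_add
      (((hD x).fun_inv (hDpos x hx).ne').const_mul h)).congr_deriv ?_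
    simp
  refine strictConvexOn_of_deriv2_pos' (convex_Ioi 0)
    (fun x hx => (hf x hx).continuousAt.continuousWithinAt) fun x hx => ?_
  have hx : 0 < x := hx
  have heq : deriv (fun x => c * x + h * (x + x ^ 2 * r x)⁻¹) =ᶠ[𝓝 x] fun x =>
      c + h * (-(1 + x ^ 2 + (2 * x + x ^ 3) * r x) / (x + x ^ 2 * r x) ^ 2) := by
    filter_upwards [Ioi_mem_nhds hx] with y hy using (hf y hy).deriv
  have hDx := hDpos x hx
  have hrx := hr0 x
  have hsecond := (((hD' x).fun_neg.fun_div ((hD x).fun_pow 2)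
    (pow_pos hDx 2).ne').const_mul h).const_add c
  simp only [Function.iterate_succ, Function.iterate_zero, Function.comp_apply, id]
  rw [heq.deriv_eq, hsecond.deriv]
  refine mul_pos hh (div_pos ?_ (by positivity))
  have hnum : 0 < 2 * (1 + x ^ 2 + (2 * x + x ^ 3) * r x) ^ 2
      - (4 * x + x ^ 3 + (2 + 5 * x ^ 2 + x ^ 4) * r x) * (x + x ^ 2 * r x) := by
    have : 0 < 2 + x ^ 4 + (6 * x + 3 * x ^ 3 + 2 * x ^ 5) * r x
        + (6 * x ^ 2 + 3 * x ^ 4 + x ^ 6) * r x ^ 2 := by positivity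
    linear_combination this
  have := mul_pos hDx hnum
  simp only [Nat.cast_ofNat, Nat.add_one_sub_one, pow_one]
  linear_combination this

/-- The function `c x + h / (x + x² r)` is coercive on `(0, ∞)`, so it attains its infimum. -/
theorem exists_isMinOn_linear_add_inv {c h : ℝ} (hc : 0 < c) (hh : 0 < h) {r : ℝ → ℝ}
    (hr0 : ∀ x, 0 ≤ r x) (hr : Continuous r) :
    ∃ x ∈ Ioi (0 : ℝ), IsMinOn (fun x => c * x + h * (x + x ^ 2 * r x)⁻¹) (Ioi 0) x := by
  set f : ℝ → ℝ := fun x => c * x + h * (x + x ^ 2 * r x)⁻¹ with hfdef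
  have hDpos : ∀ x : ℝ, 0 < x → 0 < x + x ^ 2 * r x := fun x hx => by
    have := hr0 x
    positivity
  have hlin : ∀ x : ℝ, 0 < x → c * x < f x := fun x hx => by
    have := mul_pos hh (inv_pos.2 (hDpos x hx))
    simp only [hfdef]
    linarith
  have hlim : Tendsto f (𝓝[>] 0) atTop := by
    have hD0 : Tendsto (fun x => x + x ^ 2 * r x) (𝓝[>] 0) (𝓝[>] 0) := by
      refine tendsto_nhdsWithin_iff.2 ⟨?_, ?_⟩
      · have : Continuous fun x => x + x ^ 2 * r x := by fun_prop
        simpa using (this.tendsto 0).mono_left nhdsWithin_le_nhds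
      · filter_upwards [self_mem_nhdsWithin] with x hx using hDpos x hx
    have hc0 : Tendsto (fun x : ℝ => c * x) (𝓝[>] 0) (𝓝 (c * 0)) :=
      ((continuous_const_mul c).tendsto 0).mono_left nhdsWithin_le_nhds
    exact hc0.add_atTop ((tendsto_inv_nhdsGT_zero.comp hD0).const_mul_atTop hh)
  obtain ⟨δ, hδ, hδf⟩ := mem_nhdsGT_iff_exists_Ioo_subset.1 (hlim.eventually_gt_atTop (f 1))
  have hδ : 0 < δ := hδ
  have hδ1 : δ ≤ 1 := by
    by_contra! hlt
    exact lt_irrefl (f 1) (hδf ⟨one_pos, hlt⟩)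
  have h1 : (1 : ℝ) ∈ Icc δ (f 1 / c) :=
    ⟨hδ1, (le_div_iff₀ hc).2 (by linarith [hlin 1 one_pos])⟩
  have hcont : ContinuousOn f (Icc δ (f 1 / c)) := by
    have hne : ∀ x ∈ Icc δ (f 1 / c), x + x ^ 2 * r x ≠ 0 :=
      fun x hx => (hDpos x (hδ.trans_le hx.1)).ne'
    have hDcont : Continuous fun x => x + x ^ 2 * r x := by fun_prop
    exact (continuous_const_mul c).continuousOn.add
      (continuousOn_const.mul (hDcont.continuousOn.inv₀ hne))
  obtain ⟨x, hx, hmin⟩ := isCompact_Icc.exists_isMinOn ⟨1, h1⟩ hcont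
  refine ⟨x, hδ.trans_le hx.1, fun y hy => ?_⟩
  have hy : 0 < y := hy
  have hx1 : f x ≤ f 1 := hmin h1
  change f x ≤ f y
  rcases lt_or_ge y δ with hyδ | hyδ
  · exact hx1.trans (hδf ⟨hy, hyδ⟩).le
  rcases le_or_gt y (f 1 / c) with hyc | hyc
  · exact hmin ⟨hyδ, hyc⟩
  · have := (div_lt_iff₀ hc).1 hyc
    linarith [hlin y hy]

/-- For any `c > 0` and `h > 0`, the limiting cost function
`π̄(x) = c·x + h·q̄(x)`, with `q̄(x) = (1/x)·(1 + x·Φ(x)/φ(x))⁻¹`, attains its infimum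
over `(0,∞)` at a unique point `x̄* ∈ (0,∞)`.  Here `Φ` and `φ` are the standard
normal cumulative distribution function and density. -/
theorem limiting_cost_has_unique_minimizer
    (c h : ℝ) (hc : 0 < c) (hh : 0 < h)
    (φ Φ : ℝ → ℝ)
    (hφ : ∀ x, φ x = (Real.sqrt (2 * Real.pi))⁻¹ * Real.exp (-(x ^ 2) / 2))
    (hΦ : ∀ x, Φ x = ∫ t in Set.Iic x, φ t)
    (qbar : ℝ → ℝ)
    (hqbar : ∀ x, qbar x = (1 / x) * (1 + x * Φ x / φ x)⁻¹)
    (pibar : ℝ → ℝ)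
    (hpibar : ∀ x, pibar x = c * x + h * qbar x) :
    ∃! xbar : ℝ, xbar ∈ Set.Ioi (0 : ℝ) ∧
      ∀ y ∈ Set.Ioi (0 : ℝ), pibar xbar ≤ pibar y := by
  have hφpos : ∀ x, 0 < φ x := fun x => by rw [hφ]; positivity
  have hr0 : ∀ x, 0 ≤ Φ x / φ x := fun x =>
    div_nonneg (gaussian_cdf_nonneg hφ hΦ x) (hφpos x).le
  have hr := hasDerivAt_gaussian_cdf_div_density hφ hΦ
  have hpi : pibar = fun x => c * x + h * (x + x ^ 2 * (Φ x / φ x))⁻¹ := by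
    funext x
    rw [hpibar, hqbar, one_div, ← mul_inv]
    congr 3
    ring
  have hconv := strictConvexOn_linear_add_inv (c := c) hh hr0 hr
  obtain ⟨x, hx, hmin⟩ := exists_isMinOn_linear_add_inv hc hh hr0
    (continuous_iff_continuousAt.2 fun x => (hr x).continuousAt)
  rw [← hpi] at hconv hmin
  exact ⟨x, ⟨hx, fun y hy => hmin hy⟩, fun y hy =>
    hconv.eq_of_isMinOn (fun z hz => hy.2 z hz) hmin hy.1 hx⟩
end

section
/- (o(1)-optimality of square-root staffing in the M/M/N queue.) Let x̄* be the unique minimizer over (0,∞) of π̄(x) = c·x + h·q̄(x), where q̄(x) = (1/x)·(1 + x·Φ(x)/φ(x))^{-1}. Then the square-root staffing prescription n/μ + √(n/μ)·x̄* satisfies Π_n(n/μ + √(n/μ)·x̄*) - inf_{x > n/μ} Π_n(x) → 0 as n → ∞. -/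
open Filter Topology Set

lemma log_one_add_le_cubic {u : ℝ} (hu : 0 ≤ u) :
    Real.log (1 + u) ≤ u - u ^ 2 / 2 + u ^ 3 / 3 := by
  have hd : ∀ x : ℝ, 0 ≤ x → HasDerivAt
      (fun x : ℝ => x - x ^ 2 / 2 + x ^ 3 / 3 - Real.log (1 + x))
      (1 - x + x ^ 2 - 1 / (1 + x)) x := by
    intro x hx
    have hl := ((hasDerivAt_id x).const_add 1).log (by simp; positivity)
    convert! ((((hasDerivAt_id x).sub ((hasDerivAt_pow 2 x).div_const 2)).add
      ((hasDerivAt_pow 3 x).div_const 3)).sub hl) using 1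
    simp
  have hm : MonotoneOn (fun x : ℝ => x - x ^ 2 / 2 + x ^ 3 / 3 - Real.log (1 + x)) (Ici 0) := by
    refine monotoneOn_of_hasDerivWithinAt_nonneg (convex_Ici 0)
      (fun x hx => (hd x hx).continuousAt.continuousWithinAt)
      (fun x hx => (hd x (interior_subset hx)).hasDerivWithinAt) fun x hx => ?_
    have hx0 : 0 ≤ x := interior_subset hx
    rw [sub_nonneg, div_le_iff₀ (by positivity)]
    nlinarith [pow_nonneg hx0 3]
  have := hm (mem_Ici.2 le_rfl) (mem_Ici.2 hu) hu
  simp at this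
  linarith

lemma quartic_le_log_one_add {u : ℝ} (hu : 0 ≤ u) :
    u - u ^ 2 / 2 + u ^ 3 / 3 - u ^ 4 / 4 ≤ Real.log (1 + u) := by
  have hd : ∀ x : ℝ, 0 ≤ x → HasDerivAt
      (fun x : ℝ => Real.log (1 + x) - (x - x ^ 2 / 2 + x ^ 3 / 3 - x ^ 4 / 4))
      (1 / (1 + x) - (1 - x + x ^ 2 - x ^ 3)) x := by
    intro x hx
    have hl := ((hasDerivAt_id x).const_add 1).log (by simp; positivity)
    convert! (hl.sub ((((hasDerivAt_id x).sub ((hasDerivAt_pow 2 x).div_const 2)).add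
      ((hasDerivAt_pow 3 x).div_const 3)).sub ((hasDerivAt_pow 4 x).div_const 4))) using 1
    simp
  have hm : MonotoneOn
      (fun x : ℝ => Real.log (1 + x) - (x - x ^ 2 / 2 + x ^ 3 / 3 - x ^ 4 / 4)) (Ici 0) := by
    refine monotoneOn_of_hasDerivWithinAt_nonneg (convex_Ici 0)
      (fun x hx => (hd x hx).continuousAt.continuousWithinAt)
      (fun x hx => (hd x (interior_subset hx)).hasDerivWithinAt) fun x hx => ?_
    have hx0 : 0 ≤ x := interior_subset hx
    rw [sub_nonneg, le_div_iff₀ (by positivity)]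
    nlinarith [pow_nonneg hx0 4]
  have := hm (mem_Ici.2 le_rfl) (mem_Ici.2 hu) hu
  simp at this
  linarith

lemma log_one_add_le_sub_sq_div {u : ℝ} (hu : 0 ≤ u) :
    Real.log (1 + u) ≤ u - u ^ 2 / (2 * (1 + u)) := by
  have hd : ∀ x : ℝ, 0 ≤ x → HasDerivAt
      (fun x : ℝ => (1 + x - (1 + x)⁻¹) / 2 - Real.log (1 + x))
      ((1 + 1 / (1 + x) ^ 2) / 2 - 1 / (1 + x)) x := by
    intro x hx
    have h1 : (1 : ℝ) + x ≠ 0 := by positivity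
    have h0 := (hasDerivAt_id x).const_add 1
    convert! ((h0.sub (h0.inv (by simpa using h1))).div_const 2).sub
      (h0.log (by simpa using h1)) using 1
    simp
    ring
  have hm : MonotoneOn (fun x : ℝ => (1 + x - (1 + x)⁻¹) / 2 - Real.log (1 + x)) (Ici 0) := by
    refine monotoneOn_of_hasDerivWithinAt_nonneg (convex_Ici 0)
      (fun x hx => (hd x hx).continuousAt.continuousWithinAt)
      (fun x hx => (hd x (interior_subset hx)).hasDerivWithinAt) fun x hx => ?_
    have hx0 : 0 ≤ x := interior_subset hx
    have : (1 + 1 / (1 + x) ^ 2) / 2 - 1 / (1 + x) = (1 - 1 / (1 + x)) ^ 2 / 2 := by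
      rw [sub_sq, div_pow]
      ring
    rw [this]; positivity
  have := hm (mem_Ici.2 le_rfl) (mem_Ici.2 hu) hu
  simp at this
  have h2 : u - u ^ 2 / (2 * (1 + u)) = (1 + u - (1 + u)⁻¹) / 2 := by
    field_simp
    ring
  rw [h2]; linarith

lemma abs_exp_sub_exp_le {a b M : ℝ} (ha : a ≤ M) (hb : b ≤ M) :
    |Real.exp a - Real.exp b| ≤ |a - b| * Real.exp M := by
  wlog hab : b ≤ a generalizing a b
  · rw [abs_sub_comm, abs_sub_comm a]
    exact this hb ha (le_of_not_ge hab)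
  rw [abs_of_nonneg (sub_nonneg.2 (Real.exp_le_exp.2 hab)), abs_of_nonneg (sub_nonneg.2 hab)]
  have h1 := Real.add_one_le_exp (b - a)
  have h2 : Real.exp b = Real.exp a * Real.exp (b - a) := by rw [← Real.exp_add]; ring_nf
  calc Real.exp a - Real.exp b ≤ (a - b) * Real.exp a := by
        rw [h2]; nlinarith [Real.exp_pos a]
    _ ≤ (a - b) * Real.exp M :=
        mul_le_mul_of_nonneg_left (Real.exp_le_exp.2 ha) (sub_nonneg.2 hab)

/-- Exponent of the inverse Erlang-C integrand after rescaling time by `ε = √(μ / n)`. -/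
noncomputable def erlangExponent (ε y s : ℝ) : ℝ :=
  -(s / ε) + (1 / ε ^ 2 + y / ε - 1) * Real.log (1 + ε * s)

/-- The `ε → 0` limit of `erlangExponent`. -/
noncomputable def gaussExponent (y s : ℝ) : ℝ := y * s - s ^ 2 / 2

/-- First-order coefficient in `ε` of `erlangExponent`. -/
noncomputable def exponentCorrection (y s : ℝ) : ℝ := s ^ 3 / 3 - y * s ^ 2 / 2 - s

lemma exists_erlangExponent_eq {ε s : ℝ} (hε : 0 < ε) (hs : 0 ≤ s) :
    ∃ a, 0 ≤ a ∧ s ^ 3 / 3 - ε * s ^ 4 / 4 ≤ a ∧ a ≤ s ^ 3 / 3 ∧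
      0 ≤ s - ε * s ^ 2 / 2 + ε ^ 2 * a ∧ s - ε * s ^ 2 / 2 + ε ^ 2 * a ≤ s ∧
      ∀ y, (erlangExponent ε y s - gaussExponent y s) / ε =
        a + y * (-s ^ 2 / 2 + ε * a) - (s - ε * s ^ 2 / 2 + ε ^ 2 * a) := by
  have hu : 0 ≤ ε * s := by positivity
  have h1 := log_one_add_le_cubic hu
  have h2 := quartic_le_log_one_add hu
  have h3 : 0 ≤ Real.log (1 + ε * s) := Real.log_nonneg (by linarith)
  have h4 : Real.log (1 + ε * s) ≤ ε * s := by
    have := Real.log_le_sub_one_of_pos (show 0 < 1 + ε * s by linarith)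
    linarith
  set L := Real.log (1 + ε * s) with hL
  have key : s - ε * s ^ 2 / 2 + ε ^ 2 * ((L - ε * s + (ε * s) ^ 2 / 2) / ε ^ 3) = L / ε := by
    field_simp
    ring
  have h5 : 0 ≤ L - ε * s + (ε * s) ^ 2 / 2 := by
    have h := Real.le_log_one_add_of_nonneg hu
    rw [div_le_iff₀ (by positivity)] at h
    nlinarith [pow_nonneg hu 3]
  refine ⟨(L - ε * s + (ε * s) ^ 2 / 2) / ε ^ 3, by positivity, ?_, ?_, ?_, ?_, ?_⟩
  · rw [le_div_iff₀ (by positivity)]; linarith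
  · rw [div_le_iff₀ (by positivity)]; linarith
  · rw [key]; positivity
  · rw [key, div_le_iff₀ hε]; linarith
  · intro y
    unfold erlangExponent gaussExponent
    rw [← hL]
    field_simp
    ring

lemma abs_exponent_slope_le {ε s y Y : ℝ} (hε : 0 < ε) (hs : 0 ≤ s) (hy : |y| ≤ Y) :
    |(erlangExponent ε y s - gaussExponent y s) / ε| ≤ s ^ 3 / 3 + Y * s ^ 2 / 2 + s := by
  obtain ⟨a, h0, h1, h2, h3, h4, he⟩ := exists_erlangExponent_eq hε hs
  have hεa : ε * (-s ^ 2 / 2 + ε * a) ≤ 0 := by linarith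
  have hb : -s ^ 2 / 2 + ε * a ≤ 0 := by nlinarith
  have hb' : |-s ^ 2 / 2 + ε * a| ≤ s ^ 2 / 2 := by
    rw [abs_of_nonpos hb]; linarith [mul_nonneg hε.le h0]
  have hm : |y * (-s ^ 2 / 2 + ε * a)| ≤ Y * (s ^ 2 / 2) := by
    rw [abs_mul]
    exact mul_le_mul hy hb' (abs_nonneg _) ((abs_nonneg y).trans hy)
  rw [he, abs_le]
  have := abs_le.1 hm
  constructor <;> linarith [pow_nonneg hs 3]

lemma abs_exponent_slope_sub_le {ε s y : ℝ} (hε : 0 < ε) (hs : 0 ≤ s) :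
    |(erlangExponent ε y s - gaussExponent y s) / ε - exponentCorrection y s| ≤
      ε * (s ^ 4 / 4 + |y| * (s ^ 3 / 3 + ε * s ^ 4 / 4) + s ^ 2 / 2) := by
  obtain ⟨a, h0, h1, h2, h3, h4, he⟩ := exists_erlangExponent_eq hε hs
  have ha : |a| ≤ s ^ 3 / 3 + ε * s ^ 4 / 4 := by
    rw [abs_le]
    constructor <;> linarith [pow_nonneg hs 3, mul_nonneg hε.le (pow_nonneg hs 4)]
  have hm : |y * (ε * a)| ≤ |y| * (ε * (s ^ 3 / 3 + ε * s ^ 4 / 4)) := by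
    rw [abs_mul, abs_mul, abs_of_pos hε]
    gcongr
  have := abs_le.1 hm
  rw [he, exponentCorrection, abs_le]
  have h5 : 0 ≤ ε ^ 2 * a := by positivity
  constructor <;> linarith

lemma erlangExponent_le {ε s y Y : ℝ} (hY : 0 ≤ Y) (hε : 0 < ε) (hεY : ε * (2 * (Y + 1)) ≤ 1)
    (hs : 0 ≤ s) (hy : |y| ≤ Y) : erlangExponent ε y s ≤ 2 * (Y + 1) ^ 2 - s := by
  have hu : 0 ≤ ε * s := by positivity
  have h1 := log_one_add_le_sub_sq_div hu
  have h3 : 0 ≤ Real.log (1 + ε * s) := Real.log_nonneg (by linarith)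
  have h4 : Real.log (1 + ε * s) / ε ≤ s := by
    rw [div_le_iff₀ hε]
    have := Real.log_le_sub_one_of_pos (show 0 < 1 + ε * s by linarith)
    linarith
  have h5 : Real.log (1 + ε * s) / ε ^ 2 ≤ s / ε - s ^ 2 / (1 + ε * s) / 2 := by
    rw [div_le_iff₀ (by positivity)]
    refine h1.trans_eq ?_
    field_simp
  have h6 : 2 * (Y + 1) * s - (2 * (Y + 1)) ^ 2 ≤ s ^ 2 / (1 + ε * s) := by
    rw [le_div_iff₀ (by positivity)]
    rcases le_total s (2 * (Y + 1)) with h | h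
    · have : 2 * (Y + 1) * s - (2 * (Y + 1)) ^ 2 ≤ 0 := by nlinarith
      nlinarith [mul_nonneg (sub_nonneg.2 this) hu, sq_nonneg s]
    · nlinarith [mul_nonneg (mul_nonneg (sub_nonneg.2 h) hs) (sub_nonneg.2 hεY)]
  have h7 : y * (Real.log (1 + ε * s) / ε) ≤ Y * s :=
    mul_le_mul ((le_abs_self y).trans hy) h4 (by positivity) hY
  have h8 : erlangExponent ε y s = -(s / ε) + Real.log (1 + ε * s) / ε ^ 2 +
      y * (Real.log (1 + ε * s) / ε) - Real.log (1 + ε * s) := by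
    unfold erlangExponent
    ring
  rw [h8]
  linarith

lemma gaussExponent_le {s y Y : ℝ} (hs : 0 ≤ s) (hy : |y| ≤ Y) :
    gaussExponent y s ≤ 2 * (Y + 1) ^ 2 - s := by
  have := (le_abs_self y).trans hy
  unfold gaussExponent
  nlinarith [sq_nonneg (s - (Y + 1)), mul_le_mul_of_nonneg_right this hs, sq_nonneg (Y + 1)]

/-- The inverse Erlang-C blocking probability in rescaled coordinates. -/
noncomputable def erlangIntegral (ε y : ℝ) : ℝ :=
  ∫ s in Ioi (0 : ℝ), s * Real.exp (erlangExponent ε y s)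

/-- The `ε → 0` limit of `erlangIntegral`. -/
noncomputable def gaussIntegral (y : ℝ) : ℝ :=
  ∫ s in Ioi (0 : ℝ), s * Real.exp (gaussExponent y s)

/-- First-order coefficient in `ε` of `erlangIntegral`. -/
noncomputable def integralCorrection (y : ℝ) : ℝ :=
  ∫ s in Ioi (0 : ℝ), s * (Real.exp (gaussExponent y s) * exponentCorrection y s)

lemma integrableOn_pow_mul_exp_sub (k : ℕ) (K : ℝ) :
    MeasureTheory.IntegrableOn (fun s : ℝ => s ^ k * Real.exp (K - s)) (Ioi 0) := by
  have h := (Real.GammaIntegral_convergent (s := k + 1) (by positivity)).const_mul (Real.exp K)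
  refine h.congr (Eventually.of_forall fun s => ?_)
  simp only [add_sub_cancel_right, Real.rpow_natCast, sub_eq_add_neg K, Real.exp_add]
  ring

lemma measurable_mul_exp_erlangExponent (ε y : ℝ) :
    Measurable fun s : ℝ => s * Real.exp (erlangExponent ε y s) := by
  unfold erlangExponent
  fun_prop

lemma measurable_mul_exp_gaussExponent (y : ℝ) :
    Measurable fun s : ℝ => s * Real.exp (gaussExponent y s) := by
  unfold gaussExponent
  fun_prop

lemma integrableOn_mul_exp_of_le {f : ℝ → ℝ} {K : ℝ}
    (hm : Measurable fun s : ℝ => s * Real.exp (f s)) (hf : ∀ s, 0 ≤ s → f s ≤ K - s) :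
    MeasureTheory.IntegrableOn (fun s => s * Real.exp (f s)) (Ioi 0) := by
  refine (integrableOn_pow_mul_exp_sub 1 K).mono' hm.aestronglyMeasurable ?_
  refine MeasureTheory.ae_restrict_of_forall_mem measurableSet_Ioi fun s (hs : 0 < s) => ?_
  rw [Real.norm_of_nonneg (by positivity), pow_one]
  gcongr
  exact hf s hs.le

lemma eventually_abs_le {ι : Type*} {l : Filter ι} {y : ι → ℝ} {y₀ : ℝ}
    (hy : Tendsto y l (𝓝 y₀)) : ∀ᶠ i in l, |y i| ≤ |y₀| + 1 :=
  hy.abs.eventually_le_const (lt_add_one _)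

lemma integrableOn_mul_exp_gaussExponent (y : ℝ) :
    MeasureTheory.IntegrableOn (fun s => s * Real.exp (gaussExponent y s)) (Ioi 0) :=
  integrableOn_mul_exp_of_le (measurable_mul_exp_gaussExponent y)
    fun _ hs => gaussExponent_le hs le_rfl

lemma continuous_gaussIntegral : Continuous gaussIntegral := by
  refine continuous_iff_continuousAt.2 fun y => ?_
  refine MeasureTheory.tendsto_integral_filter_of_dominated_convergence
    (fun s => s ^ 1 * Real.exp (2 * (|y| + 1 + 1) ^ 2 - s))
    (Eventually.of_forall fun z => (measurable_mul_exp_gaussExponent z).aestronglyMeasurable) ?_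
    (integrableOn_pow_mul_exp_sub 1 _) ?_
  · filter_upwards [eventually_abs_le tendsto_id] with z hz
    refine MeasureTheory.ae_restrict_of_forall_mem measurableSet_Ioi fun s (hs : 0 < s) => ?_
    rw [Real.norm_of_nonneg (by positivity), pow_one]
    gcongr
    exact gaussExponent_le hs.le hz
  · refine Eventually.of_forall fun s => ?_
    have : Continuous fun z => s * Real.exp (gaussExponent z s) := by
      unfold gaussExponent
      fun_prop
    exact this.tendsto y

lemma tendsto_exp_slope {ι : Type*} {l : Filter ι} {ε y : ι → ℝ} {y₀ s : ℝ}
    (hε : Tendsto ε l (𝓝 0)) (hpos : ∀ᶠ i in l, 0 < ε i) (hy : Tendsto y l (𝓝 y₀)) (hs : 0 ≤ s) :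
    Tendsto (fun i => (Real.exp (erlangExponent (ε i) (y i) s) -
      Real.exp (gaussExponent (y i) s)) / ε i) l
      (𝓝 (Real.exp (gaussExponent y₀ s) * exponentCorrection y₀ s)) := by
  set q : ι → ℝ := fun i => (erlangExponent (ε i) (y i) s - gaussExponent (y i) s) / ε i with hq
  have hcorr : Tendsto (fun i => exponentCorrection (y i) s) l (𝓝 (exponentCorrection y₀ s)) := by
    have : Continuous fun z => exponentCorrection z s := by
      unfold exponentCorrection
      fun_prop
    exact (this.tendsto y₀).comp hy
  have hgauss : Tendsto (fun i => Real.exp (gaussExponent (y i) s)) l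
      (𝓝 (Real.exp (gaussExponent y₀ s))) := by
    have : Continuous fun z => Real.exp (gaussExponent z s) := by
      unfold gaussExponent
      fun_prop
    exact (this.tendsto y₀).comp hy
  have hqlim : Tendsto q l (𝓝 (exponentCorrection y₀ s)) := by
    have hb : Tendsto (fun i => ε i * (s ^ 4 / 4 + |y i| * (s ^ 3 / 3 + ε i * s ^ 4 / 4)
        + s ^ 2 / 2)) l (𝓝 0) := by
      have := hε.mul (((hy.abs.mul (((hε.mul_const (s ^ 4)).div_const 4).const_add
        (s ^ 3 / 3))).const_add (s ^ 4 / 4)).add_const (s ^ 2 / 2))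
      simpa using this
    have hd : Tendsto (fun i => q i - exponentCorrection (y i) s) l (𝓝 0) := by
      refine squeeze_zero_norm' ?_ hb
      filter_upwards [hpos] with i hi
      exact abs_exponent_slope_sub_le hi hs
    simpa using hd.add hcorr
  have hεq : Tendsto (fun i => ε i * q i) l (𝓝 0) := by simpa using hε.mul hqlim
  have hslope : Tendsto (fun i => (Real.exp (ε i * q i) - 1) / ε i) l
      (𝓝 (exponentCorrection y₀ s)) := by
    have hb : Tendsto (fun i => ε i * q i ^ 2) l (𝓝 0) := by simpa using hε.mul (hqlim.pow 2)
    have hd : Tendsto (fun i => (Real.exp (ε i * q i) - 1) / ε i - q i) l (𝓝 0) := by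
      refine squeeze_zero_norm' ?_ hb
      filter_upwards [hpos, hεq.abs.eventually_le_const (by simp : |(0 : ℝ)| < 1)] with i hi hi'
      have h := Real.abs_exp_sub_one_sub_id_le hi'
      have he : (Real.exp (ε i * q i) - 1) / ε i - q i =
          (Real.exp (ε i * q i) - 1 - ε i * q i) / ε i := by field_simp
      rw [he, Real.norm_eq_abs, abs_div, abs_of_pos hi, div_le_iff₀ hi]
      linarith
    simpa using hd.add hqlim
  refine (hgauss.mul hslope).congr' ?_
  filter_upwards [hpos] with i hi
  have : erlangExponent (ε i) (y i) s = gaussExponent (y i) s + ε i * q i := by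
    rw [hq]; field_simp; ring
  rw [this, Real.exp_add]
  ring

/-- First-order expansion of `erlangIntegral`, along any converging family of arguments. -/
lemma tendsto_erlangIntegral_slope {ι : Type*} {l : Filter ι} [l.IsCountablyGenerated]
    {ε y : ι → ℝ} {y₀ : ℝ} (hε : Tendsto ε l (𝓝 0)) (hpos : ∀ᶠ i in l, 0 < ε i)
    (hy : Tendsto y l (𝓝 y₀)) :
    Tendsto (fun i => (erlangIntegral (ε i) (y i) - gaussIntegral (y i)) / ε i) l
      (𝓝 (integralCorrection y₀)) := by
  set Y := |y₀| + 1 with hYdef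
  have hY : 0 ≤ Y := by positivity
  have hsmall : ∀ᶠ i in l, ε i * (2 * (Y + 1)) ≤ 1 :=
    (hε.mul_const (2 * (Y + 1))).eventually_le_const (by simp)
  have hlim : Tendsto (fun i => ∫ s in Ioi (0 : ℝ), s * ((Real.exp (erlangExponent (ε i) (y i) s) -
      Real.exp (gaussExponent (y i) s)) / ε i)) l (𝓝 (integralCorrection y₀)) := by
    refine MeasureTheory.tendsto_integral_filter_of_dominated_convergence
      (fun s => 1 / 3 * (s ^ 4 * Real.exp (2 * (Y + 1) ^ 2 - s)) +
        Y / 2 * (s ^ 3 * Real.exp (2 * (Y + 1) ^ 2 - s)) + s ^ 2 * Real.exp (2 * (Y + 1) ^ 2 - s))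
      (Eventually.of_forall fun i => ?_) ?_
      ((((integrableOn_pow_mul_exp_sub 4 _).const_mul _).add
        ((integrableOn_pow_mul_exp_sub 3 _).const_mul _)).add
          (integrableOn_pow_mul_exp_sub 2 _)) ?_
    · refine Measurable.aestronglyMeasurable ?_
      unfold erlangExponent gaussExponent
      fun_prop
    · filter_upwards [hpos, hsmall, eventually_abs_le hy] with i hi hi' hyi
      refine MeasureTheory.ae_restrict_of_forall_mem measurableSet_Ioi fun s (hs : 0 < s) => ?_
      have h1 := abs_exp_sub_exp_le (erlangExponent_le hY hi hi' hs.le hyi)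
        (gaussExponent_le hs.le hyi)
      have h2 := abs_exponent_slope_le hi hs.le hyi
      rw [abs_div, abs_of_pos hi] at h2
      rw [Real.norm_eq_abs, abs_mul, abs_div, abs_of_pos hs, abs_of_pos hi]
      calc s * (|Real.exp (erlangExponent (ε i) (y i) s) - Real.exp (gaussExponent (y i) s)| / ε i)
          ≤ s * (|erlangExponent (ε i) (y i) s - gaussExponent (y i) s| *
              Real.exp (2 * (Y + 1) ^ 2 - s) / ε i) := by gcongr
        _ = s * ((|erlangExponent (ε i) (y i) s - gaussExponent (y i) s| / ε i) *
              Real.exp (2 * (Y + 1) ^ 2 - s)) := by ring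
        _ ≤ s * ((s ^ 3 / 3 + Y * s ^ 2 / 2 + s) * Real.exp (2 * (Y + 1) ^ 2 - s)) := by gcongr
        _ = _ := by ring
    · exact MeasureTheory.ae_restrict_of_forall_mem measurableSet_Ioi fun s (hs : 0 < s) =>
        (tendsto_exp_slope hε hpos hy hs.le).const_mul s
  refine hlim.congr' ?_
  filter_upwards [hpos, hsmall, eventually_abs_le hy] with i hi hi' hyi
  have hint := integrableOn_mul_exp_of_le (measurable_mul_exp_erlangExponent (ε i) (y i))
    fun s hs => erlangExponent_le hY hi hi' hs hyi
  rw [erlangIntegral, gaussIntegral, ← MeasureTheory.integral_sub hint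
    (integrableOn_mul_exp_gaussExponent _), ← MeasureTheory.integral_div]
  refine MeasureTheory.integral_congr_ae (Eventually.of_forall fun s => ?_)
  ring

lemma tendsto_erlangIntegral {ι : Type*} {l : Filter ι} [l.IsCountablyGenerated]
    {ε y : ι → ℝ} {y₀ : ℝ} (hε : Tendsto ε l (𝓝 0)) (hpos : ∀ᶠ i in l, 0 < ε i)
    (hy : Tendsto y l (𝓝 y₀)) :
    Tendsto (fun i => erlangIntegral (ε i) (y i)) l (𝓝 (gaussIntegral y₀)) := by
  have h := (hε.mul (tendsto_erlangIntegral_slope hε hpos hy)).add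
    ((continuous_gaussIntegral.tendsto y₀).comp hy)
  rw [zero_mul, zero_add] at h
  refine h.congr' ?_
  filter_upwards [hpos] with i hi
  simp only [Function.comp_apply]
  field_simp
  ring

lemma setIntegral_Iic_eq_setIntegral_Ioi_sub (f : ℝ → ℝ) (y : ℝ) :
    ∫ t in Iic y, f t = ∫ s in Ioi (0 : ℝ), f (y - s) := by
  rw [← MeasureTheory.integral_Ici_eq_integral_Ioi,
    ← (MeasureTheory.Measure.measurePreserving_sub_left MeasureTheory.volume y).setIntegral_preimage_emb
      (MeasurableEquiv.subLeft y).measurableEmbedding]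
  congr 2
  ext s
  simp

lemma gaussIntegral_eq {φ Φ : ℝ → ℝ}
    (hφ : ∀ x, φ x = (Real.sqrt (2 * Real.pi))⁻¹ * Real.exp (-(x ^ 2) / 2))
    (hΦ : ∀ x, Φ x = ∫ t in Set.Iic x, φ t) (y : ℝ) :
    gaussIntegral y = 1 + y * Φ y / φ y := by
  have hexp : ∀ s, φ (y - s) = φ y * Real.exp (gaussExponent y s) := fun s => by
    rw [hφ, hφ, mul_assoc, ← Real.exp_add, gaussExponent]
    ring_nf
  have hφpos : 0 < φ y := by rw [hφ]; positivity
  have hΦ' : Φ y / φ y = ∫ s in Ioi (0 : ℝ), Real.exp (gaussExponent y s) := by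
    rw [hΦ, setIntegral_Iic_eq_setIntegral_Ioi_sub]
    simp only [hexp]
    rw [MeasureTheory.integral_const_mul, mul_div_cancel_left₀ _ hφpos.ne']
  have hint0 : MeasureTheory.IntegrableOn (fun s => Real.exp (gaussExponent y s)) (Ioi 0) := by
    refine (integrableOn_pow_mul_exp_sub 0 (2 * (|y| + 1) ^ 2)).mono' ?_ ?_
    · refine Measurable.aestronglyMeasurable ?_
      unfold gaussExponent
      fun_prop
    · refine MeasureTheory.ae_restrict_of_forall_mem measurableSet_Ioi fun s (hs : 0 < s) => ?_
      rw [Real.norm_of_nonneg (by positivity), pow_zero, one_mul]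
      gcongr
      exact gaussExponent_le hs.le le_rfl
  have hlim : Tendsto (fun s => -Real.exp (gaussExponent y s)) atTop (𝓝 0) := by
    have hz : Tendsto (fun s : ℝ => Real.exp (2 * (|y| + 1) ^ 2 - s)) atTop (𝓝 0) :=
      Real.tendsto_exp_atBot.comp (tendsto_atBot_add_const_left _ _ tendsto_neg_atTop_atBot)
    refine squeeze_zero_norm' ?_ hz
    filter_upwards [eventually_ge_atTop 0] with s hs
    rw [norm_neg, Real.norm_of_nonneg (by positivity)]
    gcongr
    exact gaussExponent_le hs le_rfl
  have hder : ∀ s ∈ Ici (0 : ℝ), HasDerivAt (fun s => -Real.exp (gaussExponent y s))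
      (s * Real.exp (gaussExponent y s) - y * Real.exp (gaussExponent y s)) s := fun s _ => by
    unfold gaussExponent
    convert! (((hasDerivAt_id s).const_mul y).sub ((hasDerivAt_pow 2 s).div_const 2)).exp.neg
      using 1
    simp
    ring
  have hFTC := MeasureTheory.integral_Ioi_of_hasDerivAt_of_tendsto' hder
    ((integrableOn_mul_exp_gaussExponent y).sub (hint0.const_mul y)) hlim
  rw [MeasureTheory.integral_sub (integrableOn_mul_exp_gaussExponent y) (hint0.const_mul y),
    MeasureTheory.integral_const_mul, ← hΦ'] at hFTC
  have h0 : gaussExponent y 0 = 0 := by simp [gaussExponent]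
  rw [h0, Real.exp_zero] at hFTC
  rw [gaussIntegral, mul_div_assoc]
  linarith

/-- Rescaling time by `1 / √R` in the Erlang-C integral. -/
lemma erlangIntegral_eq {R : ℝ} (hR : 0 < R) (y : ℝ) :
    R * ∫ t in Ioi (0 : ℝ), t * Real.exp (-R * t) * (1 + t) ^ (R + Real.sqrt R * y - 1) =
      erlangIntegral (Real.sqrt R)⁻¹ y := by
  obtain ⟨r, hr, rfl⟩ : ∃ r : ℝ, 0 < r ∧ R = r ^ 2 :=
    ⟨Real.sqrt R, Real.sqrt_pos.2 hR, (Real.sq_sqrt hR.le).symm⟩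
  rw [Real.sqrt_sq hr.le]
  have h := MeasureTheory.integral_comp_mul_left_Ioi (fun t : ℝ =>
    t * Real.exp (-r ^ 2 * t) * (1 + t) ^ (r ^ 2 + r * y - 1)) 0 (inv_pos.2 hr)
  rw [mul_zero, inv_inv, smul_eq_mul] at h
  rw [pow_two r, mul_assoc, ← pow_two, ← h, ← MeasureTheory.integral_const_mul, erlangIntegral]
  refine MeasureTheory.setIntegral_congr_fun measurableSet_Ioi fun s (hs : 0 < s) => ?_
  have h1 : 0 < 1 + r⁻¹ * s := by positivity
  simp only [erlangExponent]
  rw [Real.rpow_def_of_pos h1, mul_assoc, ← Real.exp_add, ← mul_assoc, ← mul_assoc,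
    mul_inv_cancel₀ hr.ne', one_mul]
  congr 2
  field_simp

lemma erlangIntegral_nonneg (ε y : ℝ) : 0 ≤ erlangIntegral ε y :=
  MeasureTheory.setIntegral_nonneg measurableSet_Ioi fun s (hs : 0 < s) => by positivity

/-- Near-minimizers of the rescaled Erlang-C costs converge to the minimizer of the limit. -/
lemma tendsto_of_le_rescaledCost {c h : ℝ} (hc : 0 < c) (hh : 0 < h)
    (hgpos : ∀ y, 0 ≤ y → 0 < gaussIntegral y) {y₀ : ℝ} (hy₀ : 0 < y₀)
    (huniq : ∀ y, 0 < y →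
      c * y + h / (y * gaussIntegral y) ≤ c * y₀ + h / (y₀ * gaussIntegral y₀) → y = y₀)
    {ε δ y : ℕ → ℝ} (hε : Tendsto ε atTop (𝓝 0)) (hεpos : ∀ᶠ n in atTop, 0 < ε n)
    (hδ : Tendsto δ atTop (𝓝 0)) (hy : ∀ᶠ n in atTop, 0 < y n)
    (hle : ∀ᶠ n in atTop, c * y n + h / (y n * erlangIntegral (ε n) (y n)) ≤
      c * y₀ + h / (y₀ * erlangIntegral (ε n) y₀) + δ n) :
    Tendsto y atTop (𝓝 y₀) := by
  set g₀ := c * y₀ + h / (y₀ * gaussIntegral y₀) with hg₀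
  have hG : Tendsto (fun n => c * y₀ + h / (y₀ * erlangIntegral (ε n) y₀) + δ n) atTop
      (𝓝 g₀) := by
    have h1 := tendsto_erlangIntegral hε hεpos (tendsto_const_nhds (x := y₀))
    have h2 := ((tendsto_const_nhds (x := h)).div (h1.const_mul y₀)
      (mul_pos hy₀ (hgpos y₀ hy₀.le)).ne').const_add (c * y₀)
    simpa using h2.add hδ
  refine (isCompact_Icc (a := 0) (b := (g₀ + 1) / c)).tendsto_nhds_of_unique_mapClusterPt ?_ ?_
  · filter_upwards [hle, hy, hG.eventually_le_const (lt_add_one g₀)] with n h1 h2 h3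
    refine ⟨h2.le, ?_⟩
    have : 0 ≤ h / (y n * erlangIntegral (ε n) (y n)) :=
      div_nonneg hh.le (mul_nonneg h2.le (erlangIntegral_nonneg _ _))
    rw [le_div_iff₀ hc]
    linarith
  · intro z hz hcl
    let l : Filter ℕ := comap y (𝓝 z) ⊓ atTop
    have hl : l ≤ atTop := inf_le_right
    have : l.NeBot := mapClusterPt_iff_ultrafilter.1 hcl |>.elim fun U hU =>
      U.neBot.mono (le_inf (tendsto_iff_comap.1 hU.2) hU.1)
    have hyz : Tendsto y l (𝓝 z) := tendsto_comap.mono_left inf_le_left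
    have hI := tendsto_erlangIntegral (hε.mono_left hl) (hl hεpos) hyz
    have hIpos : ∀ᶠ n in l, 0 < erlangIntegral (ε n) (y n) :=
      hI.eventually_const_lt (hgpos z hz.1)
    have hmul := hyz.mul hI
    rcases hz.1.eq_or_lt with rfl | hzpos
    · have hbound : h ≤ g₀ * (0 * gaussIntegral 0) := by
        refine ge_of_tendsto ((hG.mono_left hl).mul hmul) ?_
        filter_upwards [hl hle, hl hy, hIpos] with n h1 h2 h3
        rw [← div_le_iff₀ (mul_pos h2 h3)]
        linarith [mul_pos hc h2]
      rw [zero_mul, mul_zero] at hbound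
      exact absurd hbound hh.not_ge
    · refine huniq z hzpos ?_
      exact le_of_tendsto_of_tendsto ((hyz.const_mul c).add
        (tendsto_const_nhds.div hmul (mul_pos hzpos (hgpos z hz.1)).ne'))
        (hG.mono_left hl) (hl hle)

/-- The rescaled cost at the limiting minimizer exceeds the cost along any sequence converging to
it by at most `o(ε)`. -/
lemma exists_rescaledCost_sub_le {c h : ℝ} (hh : 0 < h)
    (hgpos : ∀ y, 0 ≤ y → 0 < gaussIntegral y) {y₀ : ℝ} (hy₀ : 0 < y₀)
    (hopt : ∀ y, 0 < y →
      c * y₀ + h / (y₀ * gaussIntegral y₀) ≤ c * y + h / (y * gaussIntegral y))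
    {ε y : ℕ → ℝ} (hε : Tendsto ε atTop (𝓝 0)) (hεpos : ∀ᶠ n in atTop, 0 < ε n)
    (hy : Tendsto y atTop (𝓝 y₀)) :
    ∃ e : ℕ → ℝ, Tendsto e atTop (𝓝 0) ∧ ∀ᶠ n in atTop,
      ((c * y₀ + h / (y₀ * erlangIntegral (ε n) y₀)) -
        (c * y n + h / (y n * erlangIntegral (ε n) (y n)))) / ε n ≤ e n := by
  let D : ℝ → ℕ → ℝ := fun z n => (erlangIntegral (ε n) z - gaussIntegral z) / ε n /
    (z * (erlangIntegral (ε n) z * gaussIntegral z))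
  have hD : ∀ u : ℕ → ℝ, Tendsto u atTop (𝓝 y₀) → Tendsto (fun n => D (u n) n) atTop
      (𝓝 (integralCorrection y₀ / (y₀ * (gaussIntegral y₀ * gaussIntegral y₀)))) := fun u hu =>
    (tendsto_erlangIntegral_slope hε hεpos hu).div
      (hu.mul ((tendsto_erlangIntegral hε hεpos hu).mul
        ((continuous_gaussIntegral.tendsto y₀).comp hu)))
      (by have := hgpos y₀ hy₀.le; positivity)
  refine ⟨fun n => h * (D (y n) n - D y₀ n), ?_, ?_⟩
  · simpa using ((hD y hy).sub (hD (fun _ => y₀) tendsto_const_nhds)).const_mul h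
  · have hpos : ∀ u : ℕ → ℝ, Tendsto u atTop (𝓝 y₀) →
        ∀ᶠ n in atTop, 0 < erlangIntegral (ε n) (u n) := fun u hu =>
      (tendsto_erlangIntegral hε hεpos hu).eventually_const_lt (hgpos y₀ hy₀.le)
    filter_upwards [hεpos, hy.eventually_const_lt hy₀, hpos y hy,
      hpos (fun _ => y₀) tendsto_const_nhds] with n hn hyn hI hI₀
    have hdiff : ∀ z, 0 < z → 0 < erlangIntegral (ε n) z →
        h / (z * erlangIntegral (ε n) z) = h / (z * gaussIntegral z) - ε n * (h * D z n) := by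
      intro z hz hIz
      have := hgpos z hz.le
      simp only [D]
      field_simp
      ring
    rw [hdiff _ hy₀ hI₀, hdiff _ hyn hI, div_le_iff₀ hn]
    linarith [hopt _ hyn]

/-- `o(1)`-optimality of square-root staffing in the `M/M/N` queue:
with `x̄*` the unique minimizer over `(0,∞)` of `π̄(x) = c·x + h·q̄(x)`, the
square-root staffing prescription `n/μ + √(n/μ)·x̄*` satisfies
`Π_n(n/μ + √(n/μ)·x̄*) - inf_{x > n/μ} Π_n(x) → 0` as `n → ∞`. -/
theorem sqrt_staffing_o1_optimal_MMN
    (μ c h : ℝ) (hμ : 0 < μ) (hc : 0 < c) (hh : 0 < h)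
    -- standard normal density and cdf
    (φ Φ : ℝ → ℝ)
    (hφ : ∀ x, φ x = (Real.sqrt (2 * Real.pi))⁻¹ * Real.exp (-(x ^ 2) / 2))
    (hΦ : ∀ x, Φ x = ∫ t in Set.Iic x, φ t)
    -- extended Erlang-C blocking probability
    (Cblock : ℕ → ℝ → ℝ)
    (hCblock : ∀ (n : ℕ) (x : ℝ), Cblock n x =
      (((n : ℝ) / μ) *
        ∫ t in Set.Ioi (0 : ℝ),
          t * Real.exp (-((n : ℝ) / μ) * t) * (1 + t) ^ (x - 1))⁻¹)
    -- steady-state expected queue length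
    (EQ : ℕ → ℝ → ℝ)
    (hEQ : ∀ (n : ℕ) (x : ℝ), EQ n x = (n : ℝ) * Cblock n x / (x * μ - (n : ℝ)))
    -- total staffing cost
    (Cost : ℕ → ℝ → ℝ)
    (hCost : ∀ (n : ℕ) (x : ℝ), Cost n x = h * EQ n x + c * x)
    -- limiting (Halfin–Whitt) cost function
    (qbar : ℝ → ℝ)
    (hqbar : ∀ x, qbar x = (1 / x) * (1 + x * Φ x / φ x)⁻¹)
    (pibar : ℝ → ℝ)
    (hpibar : ∀ x, pibar x = c * x + h * qbar x)
    -- `x̄*` is the unique minimizer of `π̄` over `(0,∞)`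
    (xbar : ℝ) (hxbar : xbar ∈ Set.Ioi (0 : ℝ))
    (hxopt : ∀ y ∈ Set.Ioi (0 : ℝ), pibar xbar ≤ pibar y)
    (hxuniq : ∀ y ∈ Set.Ioi (0 : ℝ),
      (∀ z ∈ Set.Ioi (0 : ℝ), pibar y ≤ pibar z) → y = xbar) :
    Tendsto
      (fun n : ℕ =>
        Cost n ((n : ℝ) / μ + Real.sqrt ((n : ℝ) / μ) * xbar)
          - sInf (Cost n '' Set.Ioi ((n : ℝ) / μ)))
      atTop (𝓝 0) := by
  have hgauss := gaussIntegral_eq hφ hΦ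
  have hgpos : ∀ y, 0 ≤ y → 0 < gaussIntegral y := fun y hy => by
    have hφpos : ∀ x, 0 ≤ φ x := fun x => by rw [hφ]; positivity
    have hΦpos : 0 ≤ Φ y := by rw [hΦ]; exact MeasureTheory.integral_nonneg hφpos
    have := div_nonneg (mul_nonneg hy hΦpos) (hφpos y)
    rw [hgauss]
    linarith
  have hpi : ∀ y, pibar y = c * y + h / (y * gaussIntegral y) := fun y => by
    rw [hpibar, hqbar, ← hgauss, one_div, ← mul_inv, div_eq_mul_inv]
  simp only [hpi, mem_Ioi] at hxbar hxopt hxuniq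
  set ε : ℕ → ℝ := fun n => (Real.sqrt ((n : ℝ) / μ))⁻¹ with hεdef
  have hcost : ∀ n : ℕ, 0 < n → ∀ y, 0 < y →
      Cost n ((n : ℝ) / μ + Real.sqrt ((n : ℝ) / μ) * y) =
        c * (n / μ) + (c * y + h / (y * erlangIntegral (ε n) y)) / ε n := by
    intro n hn y hy
    have hn' : (0 : ℝ) < n := by exact_mod_cast hn
    have hR : 0 < (n : ℝ) / μ := by positivity
    have hr := Real.sqrt_pos.2 hR
    have hnR : (n : ℝ) = μ * Real.sqrt (n / μ) ^ 2 := by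
      rw [Real.sq_sqrt hR.le]; field_simp
    have hden : ((n : ℝ) / μ + Real.sqrt (n / μ) * y) * μ - n = μ * Real.sqrt (n / μ) * y := by
      field_simp
      ring
    rw [hCost, hEQ, hCblock, erlangIntegral_eq hR, hden]
    nth_rw 1 [hnR]
    simp only [hεdef]
    field_simp
    ring
  have hε : Tendsto ε atTop (𝓝 0) :=
    (Real.tendsto_sqrt_atTop.comp (tendsto_natCast_atTop_atTop.atTop_div_const hμ)).inv_tendsto_atTop
  have hεpos' : ∀ n : ℕ, 0 < n → 0 < ε n := fun n hn => by
    have : (0 : ℝ) < n := by exact_mod_cast hn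
    positivity
  have hεpos : ∀ᶠ n in atTop, 0 < ε n := (eventually_gt_atTop 0).mono hεpos'
  have hmem : ∀ n : ℕ, 0 < n → ∀ x, (n : ℝ) / μ < x →
      ∃ y, 0 < y ∧ x = (n : ℝ) / μ + Real.sqrt ((n : ℝ) / μ) * y := fun n hn x hx => by
    have hr : 0 < Real.sqrt ((n : ℝ) / μ) := inv_pos.1 (hεpos' n hn)
    exact ⟨(x - n / μ) / Real.sqrt (n / μ), div_pos (sub_pos.2 hx) hr, by field_simp; ring⟩
  have hbdd : ∀ n : ℕ, 0 < n → BddBelow (Cost n '' Ioi ((n : ℝ) / μ)) := fun n hn => by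
    refine ⟨0, ?_⟩
    rintro _ ⟨x, hx, rfl⟩
    obtain ⟨y, hy, rfl⟩ := hmem n hn x hx
    rw [hcost n hn y hy]
    have := erlangIntegral_nonneg (ε n) y
    have := hεpos' n hn
    positivity
  have hexists : ∀ n : ℕ, ∃ y, 0 < n → 0 < y ∧
      Cost n ((n : ℝ) / μ + Real.sqrt ((n : ℝ) / μ) * y) <
        sInf (Cost n '' Ioi ((n : ℝ) / μ)) + 1 / ((n : ℝ) + 1) := fun n => by
    rcases n.eq_zero_or_pos with rfl | hn
    · exact ⟨0, fun h => absurd h (lt_irrefl 0)⟩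
    · obtain ⟨_, ⟨x, hx, rfl⟩, hlt⟩ := Real.lt_sInf_add_pos
        (nonempty_Ioi.image (Cost n) : (Cost n '' Ioi ((n : ℝ) / μ)).Nonempty)
        (Nat.one_div_pos_of_nat (α := ℝ) (n := n))
      obtain ⟨y, hy, rfl⟩ := hmem n hn x hx
      exact ⟨y, fun _ => ⟨hy, hlt⟩⟩
  choose y hy using hexists
  have hinf : ∀ n : ℕ, 0 < n → sInf (Cost n '' Ioi ((n : ℝ) / μ)) ≤
      Cost n ((n : ℝ) / μ + Real.sqrt ((n : ℝ) / μ) * xbar) := fun n hn =>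
    csInf_le (hbdd n hn) (mem_image_of_mem _ (lt_add_of_pos_right _
      (mul_pos (inv_pos.1 (hεpos' n hn)) hxbar)))
  have htend : Tendsto (fun n : ℕ => 1 / ((n : ℝ) + 1)) atTop (𝓝 0) :=
    tendsto_one_div_add_atTop_nhds_zero_nat
  have hylim : Tendsto y atTop (𝓝 xbar) := by
    refine tendsto_of_le_rescaledCost hc hh hgpos hxbar
      (fun z hz hle => hxuniq z hz fun w hw => hle.trans (hxopt w hw)) hε hεpos
      (δ := fun n => ε n * (1 / ((n : ℝ) + 1))) (by simpa using hε.mul htend)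
      ((eventually_gt_atTop 0).mono fun n hn => (hy n hn).1) ?_
    filter_upwards [eventually_gt_atTop 0] with n hn
    have h1 := (hy n hn).2
    have h2 := hinf n hn
    rw [hcost n hn _ (hy n hn).1] at h1
    rw [hcost n hn _ hxbar] at h2
    have hεn := hεpos' n hn
    have h3 := h1.le.trans (add_le_add_left h2 _)
    rw [add_assoc, add_le_add_iff_left, div_le_iff₀ hεn, add_mul, div_mul_cancel₀ _ hεn.ne'] at h3
    linarith
  obtain ⟨e, he, hle⟩ := exists_rescaledCost_sub_le hh hgpos hxbar hxopt hε hεpos hylim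
  refine squeeze_zero' ?_ ?_ (by simpa only [add_zero] using he.add htend)
  · filter_upwards [eventually_gt_atTop 0] with n hn
    exact sub_nonneg.2 (hinf n hn)
  · filter_upwards [eventually_gt_atTop 0, hle] with n hn h1
    have h2 := (hy n hn).2
    rw [hcost n hn _ (hy n hn).1] at h2
    rw [hcost n hn _ hxbar]
    rw [sub_div] at h1
    linarith
end
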